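/- arXiv:1006.5326 — 2 statements merged into one kernel-verified Lean document; each statement's English description precedes it below -/
import Mathlib

section
/- Let n ≥ 4, m ≥ 3, and let B_1, ..., B_m be real skew-symmetric n×n matrices. Then equality Σ_{r,s=1}^m ‖[B_r,B_s]‖² = (2/3)·(Σ_{r=1}^m ‖B_r‖²)² holds if and only if there exist P ∈ O(n), R ∈ O(m) and a real number λ ≥ 0 such that, setting C_s = Σ_{r=1}^m R_{rs} Pᵀ B_r P for each s, one has C_1 = diag(D_1(λ), 0), C_2 = diag(D_2(λ), 0), C_3 = diag(D_3(λ), 0), and C_s = 0 for all s ≥ 4, where 0 denotes the (n−4)×(n−4) zero matrix and D_1(λ), D_2(λ), D_3(λ) are the 4×4 skew-symmetric matrices with rows, respectively: D_1(λ) = [[0,λ,0,0],[−λ,0,0,0],[0,0,0,λ],[0,0,−λ,0]], D_2(λ) = [[0,0,λ,0],[0,0,0,−λ],[−λ,0,0,0],[0,λ,0,0]], D_3(λ) = [[0,0,0,λ],[0,0,λ,0],[0,−λ,0,0],[−λ,0,0,0]]. -/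
open Matrix BigOperators

/-- Squared Frobenius norm of a real square matrix. -/
def frobSq {n : ℕ} (A : Matrix (Fin n) (Fin n) ℝ) : ℝ := ∑ i, ∑ j, (A i j) ^ 2

/-- Commutator of two square matrices. -/
def matComm {n : ℕ} (A B : Matrix (Fin n) (Fin n) ℝ) : Matrix (Fin n) (Fin n) ℝ :=
  A * B - B * A

/-- `D₁(λ)`. -/
def D1 (l : ℝ) : Matrix (Fin 4) (Fin 4) ℝ :=
  !![0, l, 0, 0; -l, 0, 0, 0; 0, 0, 0, l; 0, 0, -l, 0]

/-- `D₂(λ)`. -/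
def D2 (l : ℝ) : Matrix (Fin 4) (Fin 4) ℝ :=
  !![0, 0, l, 0; 0, 0, 0, -l; -l, 0, 0, 0; 0, l, 0, 0]

/-- `D₃(λ)`. -/
def D3 (l : ℝ) : Matrix (Fin 4) (Fin 4) ℝ :=
  !![0, 0, 0, l; 0, 0, l, 0; 0, -l, 0, 0; -l, 0, 0, 0]

/-- `diag(D, 0)`: the `n × n` block-diagonal matrix with upper-left `4 × 4` block `D`
and zeros elsewhere. -/
def diagBlock (n : ℕ) (D : Matrix (Fin 4) (Fin 4) ℝ) : Matrix (Fin n) (Fin n) ℝ :=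
  Matrix.of fun i j =>
    if hi : (i : ℕ) < 4 then
      if hj : (j : ℕ) < 4 then D ⟨i, hi⟩ ⟨j, hj⟩ else 0
    else 0

/-- Frobenius inner product of two real square matrices. -/
def frobInner {n : ℕ} (A B : Matrix (Fin n) (Fin n) ℝ) : ℝ := ∑ i, ∑ j, A i j * B i j

theorem frobInner_self {n : ℕ} (A : Matrix (Fin n) (Fin n) ℝ) : frobInner A A = frobSq A := by
  simp only [frobInner, frobSq, sq]

theorem frobInner_eq_trace {n : ℕ} (A B : Matrix (Fin n) (Fin n) ℝ) :
    frobInner A B = Matrix.trace (Aᵀ * B) := by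
  simp only [frobInner, Matrix.trace, Matrix.diag, Matrix.mul_apply, Matrix.transpose_apply]
  rw [Finset.sum_comm]

theorem frobInner_conj {n : ℕ} {P : Matrix (Fin n) (Fin n) ℝ}
    (hP : P ∈ Matrix.orthogonalGroup (Fin n) ℝ) (A B : Matrix (Fin n) (Fin n) ℝ) :
    frobInner (Pᵀ * A * P) (Pᵀ * B * P) = frobInner A B := by
  have h : P * Pᵀ = 1 := (Matrix.mem_orthogonalGroup_iff (Fin n) ℝ).1 hP
  have e : (Pᵀ * A * P)ᵀ * (Pᵀ * B * P) = Pᵀ * (Aᵀ * (P * Pᵀ) * B * P) := by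
    simp only [Matrix.transpose_mul, Matrix.transpose_transpose, Matrix.mul_assoc]
  rw [frobInner_eq_trace, frobInner_eq_trace, e, h, Matrix.trace_mul_comm, Matrix.mul_one,
    Matrix.mul_assoc, h, Matrix.mul_one]

theorem frobSq_conj {n : ℕ} {P : Matrix (Fin n) (Fin n) ℝ}
    (hP : P ∈ Matrix.orthogonalGroup (Fin n) ℝ) (A : Matrix (Fin n) (Fin n) ℝ) :
    frobSq (Pᵀ * A * P) = frobSq A := by
  rw [← frobInner_self, frobInner_conj hP, frobInner_self]

theorem matComm_conj {n : ℕ} {P : Matrix (Fin n) (Fin n) ℝ}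
    (hP : P ∈ Matrix.orthogonalGroup (Fin n) ℝ) (A B : Matrix (Fin n) (Fin n) ℝ) :
    matComm (Pᵀ * A * P) (Pᵀ * B * P) = Pᵀ * matComm A B * P := by
  have h : P * Pᵀ = 1 := (Matrix.mem_orthogonalGroup_iff (Fin n) ℝ).1 hP
  have key : ∀ X Y : Matrix (Fin n) (Fin n) ℝ,
      Pᵀ * X * P * (Pᵀ * Y * P) = Pᵀ * (X * Y) * P := fun X Y => by
    calc Pᵀ * X * P * (Pᵀ * Y * P) = Pᵀ * X * (P * Pᵀ) * Y * P := by
          simp only [Matrix.mul_assoc]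
      _ = _ := by rw [h]; simp only [Matrix.mul_assoc, Matrix.mul_one]
  rw [matComm, matComm, key, key, Matrix.mul_sub, Matrix.sub_mul]

theorem sum_sq_rotate {m : ℕ} {R : Matrix (Fin m) (Fin m) ℝ}
    (hR : R ∈ Matrix.orthogonalGroup (Fin m) ℝ) (v : Fin m → ℝ) :
    ∑ s, (∑ r, R r s * v r) ^ 2 = ∑ r, v r ^ 2 := by
  have h : R * Rᵀ = 1 := (Matrix.mem_orthogonalGroup_iff (Fin m) ℝ).1 hR
  have e : ∑ s, (∑ r, R r s * v r) ^ 2 = (v ᵥ* R) ⬝ᵥ (v ᵥ* R) := by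
    simp only [dotProduct, Matrix.vecMul, sq, mul_comm]
  have e2 : (v ᵥ* R) ⬝ᵥ (v ᵥ* R) = v ⬝ᵥ v := by
    conv_lhs => rw [← Matrix.dotProduct_mulVec, ← Matrix.mulVec_transpose R v,
      Matrix.mulVec_mulVec, h, Matrix.one_mulVec]
  rw [e, e2]
  simp only [dotProduct, sq]

theorem sum_frobSq_rotate {n m : ℕ} {R : Matrix (Fin m) (Fin m) ℝ}
    (hR : R ∈ Matrix.orthogonalGroup (Fin m) ℝ) (V : Fin m → Matrix (Fin n) (Fin n) ℝ) :
    ∑ s, frobSq (∑ r, R r s • V r) = ∑ r, frobSq (V r) := by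
  simp only [frobSq, Matrix.sum_apply, Matrix.smul_apply, smul_eq_mul]
  rw [Finset.sum_comm, Finset.sum_comm (s := Finset.univ (α := Fin m))]
  refine Finset.sum_congr rfl fun i _ => ?_
  rw [Finset.sum_comm, Finset.sum_comm (s := Finset.univ (α := Fin m))]
  exact Finset.sum_congr rfl fun j _ => sum_sq_rotate hR fun r => V r i j

theorem matComm_sum_left {n m : ℕ} (c : Fin m → ℝ) (V : Fin m → Matrix (Fin n) (Fin n) ℝ)
    (B : Matrix (Fin n) (Fin n) ℝ) :
    matComm (∑ r, c r • V r) B = ∑ r, c r • matComm (V r) B := by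
  simp only [matComm, Matrix.sum_mul, Matrix.mul_sum, Matrix.smul_mul, Matrix.mul_smul,
    smul_sub, Finset.sum_sub_distrib]

theorem matComm_sum_right {n m : ℕ} (c : Fin m → ℝ) (V : Fin m → Matrix (Fin n) (Fin n) ℝ)
    (B : Matrix (Fin n) (Fin n) ℝ) :
    matComm B (∑ r, c r • V r) = ∑ r, c r • matComm B (V r) := by
  simp only [matComm, Matrix.sum_mul, Matrix.mul_sum, Matrix.smul_mul, Matrix.mul_smul,
    smul_sub, Finset.sum_sub_distrib]

theorem sum_frobSq_matComm_rotate {n m : ℕ} {R : Matrix (Fin m) (Fin m) ℝ}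
    (hR : R ∈ Matrix.orthogonalGroup (Fin m) ℝ) (V : Fin m → Matrix (Fin n) (Fin n) ℝ) :
    ∑ s, ∑ t, frobSq (matComm (∑ r, R r s • V r) (∑ r, R r t • V r)) =
      ∑ s, ∑ t, frobSq (matComm (V s) (V t)) := by
  simp only [matComm_sum_right _ _ (∑ r, _ • V r), sum_frobSq_rotate hR]
  rw [Finset.sum_comm]
  simp only [matComm_sum_left, sum_frobSq_rotate hR]
  rw [Finset.sum_comm]

/-- Simultaneous orthogonal conjugation and rotation of the tuple preserve both sides of the
commutator inequality. -/
theorem equality_iff_of_transform {n m : ℕ} {P : Matrix (Fin n) (Fin n) ℝ}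
    (hP : P ∈ Matrix.orthogonalGroup (Fin n) ℝ) {R : Matrix (Fin m) (Fin m) ℝ}
    (hR : R ∈ Matrix.orthogonalGroup (Fin m) ℝ) (B : Fin m → Matrix (Fin n) (Fin n) ℝ)
    {C : Fin m → Matrix (Fin n) (Fin n) ℝ} (hC : ∀ s, C s = ∑ r, R r s • (Pᵀ * B r * P)) :
    (∑ r, ∑ s, frobSq (matComm (C r) (C s)) = (2 / 3) * (∑ r, frobSq (C r)) ^ 2) ↔
      (∑ r, ∑ s, frobSq (matComm (B r) (B s)) = (2 / 3) * (∑ r, frobSq (B r)) ^ 2) := by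
  simp only [hC, sum_frobSq_matComm_rotate hR, sum_frobSq_rotate hR, matComm_conj hP,
    frobSq_conj hP]

theorem LinearMap.exists_orthonormalBasis_of_skew (d : ℕ) :
    ∀ (E : Type) [NormedAddCommGroup E] [InnerProductSpace ℝ E] [FiniteDimensional ℝ E]
      (A : E →ₗ[ℝ] E), (∀ x y, inner ℝ (A x) y = -inner ℝ x (A y)) →
      Module.finrank ℝ E = d →
      ∃ (ι : Type) (_ : Fintype ι) (b : OrthonormalBasis ι ℝ E) (σ : ι → ι) (c : ι → ℝ),
        Function.Involutive σ ∧ (∀ i, c (σ i) = -c i) ∧ ∀ i, A (b i) = c i • b (σ i) := by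
  induction d using Nat.strong_induction_on with
  | _ d ih =>
  intro E _ _ _ A hA hd
  have hself : ∀ x, inner ℝ (A x) x = 0 := fun x => by
    have := hA x x
    rw [real_inner_comm x (A x)] at this ⊢
    linarith
  by_cases hzero : A = 0
  · exact ⟨Fin d, inferInstance, (stdOrthonormalBasis ℝ E).reindex (finCongr hd), _root_.id, 0,
      fun _ => rfl, by simp, by simp [hzero]⟩
  have hsymm : (A ∘ₗ A).IsSymmetric := fun x y => by
    simp only [LinearMap.comp_apply, hA, neg_neg]
  obtain ⟨i, hi⟩ : ∃ i, A (hsymm.eigenvectorBasis hd i) ≠ 0 := by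
    by_contra! h
    exact hzero (Module.Basis.ext (hsymm.eigenvectorBasis hd).toBasis fun i => by simp [h i])
  obtain ⟨e, he, he1, c, hec⟩ : ∃ e : E, A e ≠ 0 ∧ ‖e‖ = 1 ∧ ∃ c : ℝ, A (A e) = c • e :=
    ⟨_, hi, (hsymm.eigenvectorBasis hd).norm_eq_one i, _, hsymm.apply_eigenvectorBasis hd i⟩
  set t : ℝ := ‖A e‖ with ht
  have htpos : 0 < t := norm_pos_iff.2 he
  have hc : c = -(t * t) := by
    have h := hA e (A e)
    rw [hec, inner_smul_right, real_inner_self_eq_norm_mul_norm, real_inner_self_eq_norm_mul_norm,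
      he1] at h
    linarith
  set f : E := t⁻¹ • A e with hf
  have hAe : A e = t • f := by rw [hf, smul_smul, mul_inv_cancel₀ htpos.ne', one_smul]
  have hAf : A f = (-t) • e := by
    rw [hf, map_smul, hec, hc, smul_smul]
    congr 1
    field_simp
  have hf1 : ‖f‖ = 1 := by
    rw [hf, norm_smul, norm_inv, Real.norm_of_nonneg htpos.le, ← ht, inv_mul_cancel₀ htpos.ne']
  have hef : inner ℝ e f = 0 := by
    rw [hf, inner_smul_right, real_inner_comm, hself, mul_zero]
  let v : Bool → E := fun s => if s then f else e
  have hv : Orthonormal ℝ v := by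
    refine ⟨fun s => by cases s <;> simp [v, he1, hf1], fun s s' hs => ?_⟩
    cases s <;> cases s' <;> simp [v, hef, real_inner_comm] at hs ⊢
  let W : Submodule ℝ E := (Submodule.span ℝ (Set.range v))ᗮ
  have hWmem : ∀ x : E, x ∈ W ↔ inner ℝ e x = 0 ∧ inner ℝ f x = 0 := fun x => by
    simp only [W, Submodule.mem_orthogonal']
    constructor
    · intro h
      have h0 := h e (Submodule.subset_span ⟨false, rfl⟩)
      have h1 := h f (Submodule.subset_span ⟨true, rfl⟩)
      exact ⟨by rwa [real_inner_comm], by rwa [real_inner_comm]⟩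
    · rintro ⟨h0, h1⟩ u hu
      induction hu using Submodule.span_induction with
      | mem u hu =>
        obtain ⟨s, rfl⟩ := hu
        rw [real_inner_comm]
        cases s
        · exact h0
        · exact h1
      | zero => simp
      | add a b _ _ ha hb => rw [inner_add_right, ha, hb, add_zero]
      | smul r a _ ha => rw [inner_smul_right, ha, mul_zero]
  have hWinv : ∀ x ∈ W, A x ∈ W := fun x hx => by
    rw [hWmem] at hx ⊢
    have h0 := hA e x
    have h1 := hA f x
    rw [hAe, inner_smul_left, hx.2] at h0
    rw [hAf, inner_smul_left, hx.1] at h1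
    constructor <;> simp at h0 h1 <;> assumption
  have hspan : Module.finrank ℝ (Submodule.span ℝ (Set.range v)) = 2 := by
    rw [finrank_span_eq_card hv.linearIndependent, Fintype.card_bool]
  have hdim : 2 + Module.finrank ℝ W = d := by
    rw [← hspan, ← hd]
    exact Submodule.finrank_add_finrank_orthogonal _
  obtain ⟨ι, _, b, σ, k, hσ, hk, hb⟩ := ih (Module.finrank ℝ W) (by omega) W
    (A.restrict hWinv) (fun x y => hA x y) rfl
  have hcard : Fintype.card ι = Module.finrank ℝ W := (Module.finrank_eq_card_basis b.toBasis).symm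
  let u : ι ⊕ Bool → E := Sum.elim (fun i => (b i : E)) v
  have hbv : ∀ i s, inner ℝ (b i : E) (v s) = 0 := fun i s => by
    have h := (hWmem _).1 (b i).2
    rw [real_inner_comm]
    cases s
    · exact h.1
    · exact h.2
  have hu : Orthonormal ℝ u := by
    constructor
    · rintro (i | s)
      · exact b.norm_eq_one i
      · exact hv.1 s
    · rintro (i | s) (j | s') hne
      · exact b.orthonormal.2 (fun h => hne (congrArg Sum.inl h))
      · exact hbv i s'
      · exact (real_inner_comm _ _).trans (hbv j s)
      · exact hv.2 (fun h => hne (congrArg Sum.inr h))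
  have hucard : Fintype.card (ι ⊕ Bool) = Module.finrank ℝ E := by
    rw [Fintype.card_sum, hcard, Fintype.card_bool]
    omega
  let B := basisOfOrthonormalOfCardEqFinrank hu hucard
  have hB : ⇑B = u := coe_basisOfOrthonormalOfCardEqFinrank hu hucard
  refine ⟨ι ⊕ Bool, inferInstance, B.toOrthonormalBasis (by rw [hB]; exact hu),
    Sum.map σ not, Sum.elim k (fun s => if s then -t else t), ?_, ?_, ?_⟩
  · rintro (i | s)
    · simp [hσ i]
    · simp
  · rintro (i | s)
    · simp [hk i]
    · cases s <;> simp
  · rintro (i | s)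
    · have := congrArg Subtype.val (hb i)
      simpa [hB, u] using this
    · cases s
      · simpa [hB, u, v] using hAe
      · simpa [hB, u, v] using hAf

/-- Orthogonal normal form of a real skew-symmetric matrix. -/
theorem Matrix.exists_orthogonal_normal_form_of_skew {n : ℕ} (A : Matrix (Fin n) (Fin n) ℝ)
    (hA : Aᵀ = -A) :
    ∃ P ∈ Matrix.orthogonalGroup (Fin n) ℝ, ∃ (σ : Fin n → Fin n) (c : Fin n → ℝ),
      Function.Involutive σ ∧ (∀ i, c (σ i) = -c i) ∧
        ∀ i j, (Pᵀ * A * P) i j = if i = σ j then c j else 0 := by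
  have hAij : ∀ i j, A j i = -A i j := fun i j => congrFun (congrFun hA i) j
  obtain ⟨ι, _, b, σ, c, hσ, hc, hb⟩ := LinearMap.exists_orthonormalBasis_of_skew n
    (EuclideanSpace ℝ (Fin n)) (Matrix.toEuclideanLin A) (fun x y => by
      simp only [PiLp.inner_apply, Matrix.toLpLin_apply, Matrix.mulVec, dotProduct,
        RCLike.inner_apply, conj_trivial, Finset.mul_sum, Finset.sum_mul]
      rw [Finset.sum_comm, ← Finset.sum_neg_distrib]
      refine Finset.sum_congr rfl fun i _ => ?_
      rw [← Finset.sum_neg_distrib]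
      refine Finset.sum_congr rfl fun j _ => ?_
      rw [hAij i j]
      ring) (by simp)
  classical
  have hcard : Fintype.card ι = n := by
    rw [← Module.finrank_eq_card_basis b.toBasis]
    simp
  let ε : ι ≃ Fin n := Fintype.equivFinOfCardEq hcard
  let P : Matrix (Fin n) (Fin n) ℝ := Matrix.of fun i j => b (ε.symm j) i
  have hPP : ∀ i j, ∑ k, P k i * P k j = if i = j then 1 else 0 := fun i j => by
    have h := orthonormal_iff_ite.1 b.orthonormal (ε.symm i) (ε.symm j)
    simpa [PiLp.inner_apply, P, mul_comm] using h
  refine ⟨P, (Matrix.mem_orthogonalGroup_iff' (Fin n) ℝ).2 ?_, fun i => ε (σ (ε.symm i)),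
    fun i => c (ε.symm i), fun i => by simp [hσ _], fun i => by simp [hc], fun i j => ?_⟩
  · ext i j
    rw [Matrix.one_apply, ← hPP i j]
    rfl
  · have h1 : ∀ k, (A * P) k j = c (ε.symm j) * P k (ε (σ (ε.symm j))) := fun k => by
      have := congrArg (fun x : EuclideanSpace ℝ (Fin n) => x k) (hb (ε.symm j))
      simpa [P, Matrix.mul_apply, Matrix.mulVec, dotProduct, Matrix.toLpLin_apply] using this
    rw [Matrix.mul_assoc, Matrix.mul_apply]
    simp only [Matrix.transpose_apply, h1]
    have h2 := hPP i (ε (σ (ε.symm j)))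
    calc ∑ k, P k i * (c (ε.symm j) * P k (ε (σ (ε.symm j))))
        = c (ε.symm j) * ∑ k, P k i * P k (ε (σ (ε.symm j))) := by
          rw [Finset.mul_sum]
          exact Finset.sum_congr rfl fun k _ => by ring
      _ = _ := by rw [h2]; split_ifs <;> simp

theorem Finset.sum_sum_max_sq_add_le_one {ι : Type*} [DecidableEq ι] (S : Finset ι) (ν : ι → ℝ)
    (hν : ∀ i, 0 ≤ ν i) (hS : ∑ i ∈ S, ν i ^ 2 ≤ 1 / 2) :
    ∑ i ∈ S, ∑ j ∈ S, (if i = j then 0 else max 0 ((ν i + ν j) ^ 2 - 1 / 2)) ≤ 1 := by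
  set G : ι → ι → ℝ := fun i j => if i = j then 0 else max 0 ((ν i + ν j) ^ 2 - 1 / 2) with hG
  change ∑ i ∈ S, ∑ j ∈ S, G i j ≤ 1
  have hGsymm : ∀ i j, G i j = G j i := fun i j => by
    simp only [hG, eq_comm (a := i), add_comm (ν i)]
  have hGzero : ∀ i j, ¬ 1 / 2 < (ν i + ν j) ^ 2 → G i j = 0 := fun i j h => by
    simp only [hG]
    split_ifs
    · rfl
    · exact max_eq_left (by linarith)
  have hsub : ∀ T ⊆ S, ∑ i ∈ T, ν i ^ 2 ≤ 1 / 2 := fun T hT =>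
    (Finset.sum_le_sum_of_subset_of_nonneg hT fun _ _ _ => sq_nonneg _).trans hS
  rcases S.eq_empty_or_nonempty with rfl | hne
  · simp
  obtain ⟨o, ho, hmax⟩ := S.exists_max_image ν hne
  by_cases hstar : ∀ k ∈ S, ∀ l ∈ S, k ≠ o → l ≠ o → G k l = 0
  · have hrow : ∀ k ∈ S.erase o, ∑ l ∈ S, G k l = G o k := fun k hk => by
      rw [Finset.mem_erase] at hk
      rw [Finset.sum_eq_single_of_mem o ho fun l hl hlo => hstar k hk.2 l hl hk.1 hlo, hGsymm]
    have hoo : G o o = 0 := if_pos rfl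
    rw [← Finset.add_sum_erase _ _ ho, Finset.sum_congr rfl hrow, ← Finset.add_sum_erase _ _ ho,
      hoo]
    set J := (S.erase o).filter fun j => 1 / 2 < (ν o + ν j) ^ 2 with hJ
    have hJS : J ⊆ S.erase o := Finset.filter_subset _ _
    have hJo : o ∉ J := fun h => by simpa using hJS h
    have hval : ∑ k ∈ S.erase o, G o k = ∑ k ∈ J, ((ν o + ν k) ^ 2 - 1 / 2) := by
      rw [hJ, Finset.sum_filter]
      refine Finset.sum_congr rfl fun k hk => ?_
      split_ifs with h
      · simp only [hG]
        rw [if_neg (Finset.ne_of_mem_erase hk).symm, max_eq_right (by linarith)]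
      · exact hGzero _ _ h
    have hexp : ∑ k ∈ J, ((ν o + ν k) ^ 2 - 1 / 2) =
        J.card * (ν o ^ 2 - 1 / 2) + 2 * ν o * ∑ k ∈ J, ν k + ∑ k ∈ J, ν k ^ 2 := by
      rw [Finset.mul_sum, ← nsmul_eq_mul, ← Finset.sum_const, ← Finset.sum_add_distrib,
        ← Finset.sum_add_distrib]
      exact Finset.sum_congr rfl fun k _ => by ring
    have hle : ν o ^ 2 + ∑ k ∈ J, ν k ^ 2 ≤ 1 / 2 := by
      rw [← Finset.sum_insert (f := fun k => ν k ^ 2) hJo]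
      exact hsub _ (Finset.insert_subset ho (hJS.trans (Finset.erase_subset _ _)))
    have hcs : (∑ k ∈ J, ν k) ^ 2 ≤ J.card * ∑ k ∈ J, ν k ^ 2 := sq_sum_le_card_mul_sum_sq
    have hN : (0 : ℝ) ≤ J.card := Nat.cast_nonneg _
    rw [hval, hexp]
    nlinarith [mul_le_mul_of_nonneg_left hle hN, sq_nonneg (ν o - ∑ k ∈ J, ν k)]
  · push Not at hstar
    obtain ⟨k, hk, l, hl, hko, hlo, hkl⟩ := hstar
    have hkl' : k ≠ l := fun h => hkl (if_pos h)
    have ekl : 1 / 2 < (ν k + ν l) ^ 2 := by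
      by_contra h
      exact hkl (hGzero _ _ h)
    have eok : 1 / 2 < (ν o + ν k) ^ 2 := by nlinarith [hν o, hν k, hν l, hmax k hk, hmax l hl]
    have eol : 1 / 2 < (ν o + ν l) ^ 2 := by nlinarith [hν o, hν k, hν l, hmax k hk, hmax l hl]
    have hdisj : ∀ i ∈ S, ∀ j ∈ S, ∀ a ∈ S, ∀ b ∈ S, i ≠ j → i ≠ a → i ≠ b → j ≠ a → j ≠ b →
        a ≠ b → 1 / 2 < (ν a + ν b) ^ 2 → ¬ 1 / 2 < (ν i + ν j) ^ 2 := by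
      intro i hi j hj a ha b hb h1 h2 h3 h4 h5 h6 hab hij
      have := hsub {i, j, a, b} (by simp [Finset.insert_subset_iff, *])
      rw [Finset.sum_insert (by simp [*]), Finset.sum_insert (by simp [*]),
        Finset.sum_insert (by simp [*]), Finset.sum_singleton] at this
      nlinarith [sq_nonneg (ν a - ν b), sq_nonneg (ν i - ν j)]
    have hout : ∀ i ∈ S, ∀ j ∈ S, i ∉ ({o, k, l} : Finset ι) → G i j = 0 := by
      intro i hi j hj hiT
      simp only [Finset.mem_insert, Finset.mem_singleton, not_or] at hiT
      obtain ⟨h1, h2, h3⟩ := hiT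
      by_cases hij : i = j
      · exact if_pos hij
      refine hGzero _ _ ?_
      by_cases hjk : j = k
      · exact hdisj i hi j hj o ho l hl hij h1 h3 (hjk ▸ hko) (hjk ▸ hkl') hlo.symm eol
      by_cases hjl : j = l
      · exact hdisj i hi j hj o ho k hk hij h1 h2 (hjl ▸ hlo) (hjl ▸ hkl'.symm) hko.symm eok
      · exact hdisj i hi j hj k hk l hl hij h2 h3 hjk hjl hkl' ekl
    have hTS : ({o, k, l} : Finset ι) ⊆ S := by simp [Finset.insert_subset_iff, *]
    have hT := hsub _ hTS
    have hrow : ∀ i ∈ S, ∑ j ∈ S, G i j = ∑ j ∈ {o, k, l}, G i j := fun i hi =>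
      (Finset.sum_subset hTS fun j hj hjT => by rw [hGsymm, hout j hj i hi hjT]).symm
    rw [← Finset.sum_subset hTS fun i hi hiT => Finset.sum_eq_zero fun j hj => hout i hi j hj hiT,
      Finset.sum_congr rfl fun i hi => hrow i (hTS hi)]
    have hsum : ∀ F : ι → ℝ, ∑ i ∈ {o, k, l}, F i = F o + (F k + F l) := fun F => by
      rw [Finset.sum_insert (by simp [hko.symm, hlo.symm]), Finset.sum_insert (by simp [hkl']),
        Finset.sum_singleton]
    have hval : ∀ i j, i ≠ j → 1 / 2 < (ν i + ν j) ^ 2 → G i j = (ν i + ν j) ^ 2 - 1 / 2 :=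
      fun i j hij h => by
        simp only [hG]
        rw [if_neg hij, max_eq_right (by linarith)]
    have hdiag : ∀ i, G i i = 0 := fun i => if_pos rfl
    rw [hsum] at hT
    simp only [hsum, hdiag, hGsymm k o, hGsymm l o, hGsymm l k, hval o k hko.symm eok,
      hval o l hlo.symm eol, hval k l hkl' ekl]
    nlinarith [sq_nonneg (ν o - ν k), sq_nonneg (ν o - ν l), sq_nonneg (ν k - ν l)]

theorem Function.Involutive.sum_eq_two_mul_sum_filter {n : ℕ} {σ : Fin n → Fin n}
    (hσ : Function.Involutive σ) (F : Fin n → ℝ) (hF : ∀ k, F (σ k) = F k)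
    (hfix : ∀ k, σ k = k → F k = 0) :
    ∑ k, F k = 2 * ∑ k with k < σ k, F k := by
  have h1 : ∑ k with σ k < k, F k = ∑ k with k < σ k, F k := by
    rw [Finset.sum_filter, Finset.sum_filter, ← Equiv.sum_comp (hσ.toPerm σ)]
    exact Finset.sum_congr rfl fun k _ => by simp [hσ k, hF k]
  have h2 : ∀ k, F k = (if k < σ k then F k else 0) + if σ k < k then F k else 0 := fun k => by
    rcases lt_trichotomy k (σ k) with h | h | h
    · simp [h, h.not_gt]
    · simp [← h, hfix k h.symm]
    · simp [h, h.not_gt]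
  rw [Finset.sum_congr rfl fun k _ => h2 k, Finset.sum_add_distrib, ← Finset.sum_filter,
    ← Finset.sum_filter, h1]
  ring

/-- `A` is in orthogonal normal form: up to scalars it permutes the coordinate vectors by the
involution `σ`. -/
structure IsSkewNormal {n : ℕ} (A : Matrix (Fin n) (Fin n) ℝ) (σ : Fin n → Fin n)
    (c : Fin n → ℝ) : Prop where
  invol : Function.Involutive σ
  neg : ∀ i, c (σ i) = -c i
  apply : ∀ i j, A i j = if i = σ j then c j else 0

namespace IsSkewNormal

variable {n : ℕ} {A : Matrix (Fin n) (Fin n) ℝ} {σ : Fin n → Fin n} {c : Fin n → ℝ}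

theorem eq_zero_of_fixed (h : IsSkewNormal A σ c) {k : Fin n} (hk : σ k = k) : c k = 0 := by
  have := h.neg k
  rw [hk] at this
  linarith

theorem matComm_apply (h : IsSkewNormal A σ c) (B : Matrix (Fin n) (Fin n) ℝ) (k l : Fin n) :
    matComm A B k l = -(c k * B (σ k) l + c l * B k (σ l)) := by
  have h1 : (A * B) k l = -(c k * B (σ k) l) := by
    rw [Matrix.mul_apply, Finset.sum_eq_single_of_mem (σ k) (Finset.mem_univ _), h.apply,
      h.invol k, if_pos rfl, h.neg]
    · ring
    · intro j _ hj
      rw [h.apply, if_neg (fun e => hj (by rw [e, h.invol j])), zero_mul]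
  have h2 : (B * A) k l = c l * B k (σ l) := by
    rw [Matrix.mul_apply, Finset.sum_eq_single_of_mem (σ l) (Finset.mem_univ _), h.apply,
      if_pos rfl]
    · ring
    · intro j _ hj
      rw [h.apply, if_neg hj, mul_zero]
  rw [matComm, Matrix.sub_apply, h1, h2]
  ring

theorem frobSq_eq (h : IsSkewNormal A σ c) : frobSq A = ∑ k, c k ^ 2 := by
  rw [frobSq, Finset.sum_comm]
  refine Finset.sum_congr rfl fun j _ => ?_
  rw [Finset.sum_eq_single_of_mem (σ j) (Finset.mem_univ _), h.apply, if_pos rfl]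
  intro i _ hi
  rw [h.apply, if_neg hi]
  norm_num

theorem two_mul_frobSq (h : IsSkewNormal A σ c) (B : Matrix (Fin n) (Fin n) ℝ) :
    2 * frobSq B = ∑ k, ∑ l, (B (σ k) l ^ 2 + B k (σ l) ^ 2) := by
  simp only [Finset.sum_add_distrib]
  have h1 : ∑ k, ∑ l, B (σ k) l ^ 2 = frobSq B :=
    Equiv.sum_comp (h.invol.toPerm σ) fun k => ∑ l, B k l ^ 2
  have h2 : ∑ k, ∑ l, B k (σ l) ^ 2 = frobSq B :=
    Finset.sum_congr rfl fun k _ => Equiv.sum_comp (h.invol.toPerm σ) fun l => B k l ^ 2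
  rw [h1, h2]
  ring

theorem two_mul_frobSq_matComm (h : IsSkewNormal A σ c) (B : Matrix (Fin n) (Fin n) ℝ) :
    2 * frobSq (matComm A B) = ∑ k, ∑ l, ((c k * B (σ k) l + c l * B k (σ l)) ^ 2 +
      (c k * B k (σ l) + c l * B (σ k) l) ^ 2) := by
  simp only [Finset.sum_add_distrib]
  have h1 : ∑ k, ∑ l, (c k * B (σ k) l + c l * B k (σ l)) ^ 2 = frobSq (matComm A B) := by
    simp only [frobSq, h.matComm_apply, neg_sq]
  have h2 : ∑ k, ∑ l, (c k * B k (σ l) + c l * B (σ k) l) ^ 2 = frobSq (matComm A B) := by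
    rw [← h1, ← Equiv.sum_comp (h.invol.toPerm σ)]
    refine Finset.sum_congr rfl fun k _ => ?_
    rw [← Equiv.sum_comp (h.invol.toPerm σ)]
    refine Finset.sum_congr rfl fun l _ => ?_
    simp only [Function.Involutive.coe_toPerm, h.invol k, h.invol l, h.neg]
    ring
  rw [h1, h2]
  ring

theorem sum_sq_le (h : IsSkewNormal A σ c) (hA : frobSq A ≤ 1) {k l : Fin n} (h1 : l ≠ k)
    (h2 : l ≠ σ k) : c k ^ 2 + c l ^ 2 ≤ 1 / 2 := by
  rw [h.frobSq_eq] at hA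
  have hsub : ∀ T : Finset (Fin n), ∑ i ∈ T, c i ^ 2 ≤ 1 := fun T =>
    (Finset.sum_le_sum_of_subset_of_nonneg (Finset.subset_univ T) fun _ _ _ => sq_nonneg _).trans hA
  have h3 : σ l ≠ k := fun e => h2 (by rw [← e, h.invol l])
  have h4 : σ l ≠ σ k := fun e => h1 (h.invol.injective e)
  have hpair : ∀ i, σ i ≠ i → c i ^ 2 ≤ 1 / 2 := fun i hi => by
    have := hsub {i, σ i}
    rw [Finset.sum_pair hi.symm, h.neg] at this
    linarith
  by_cases hk : σ k = k
  · rw [h.eq_zero_of_fixed hk]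
    by_cases hl : σ l = l
    · rw [h.eq_zero_of_fixed hl]
      norm_num
    · linarith [hpair l hl]
  by_cases hl : σ l = l
  · rw [h.eq_zero_of_fixed hl]
    linarith [hpair k hk]
  have := hsub {k, σ k, l, σ l}
  rw [Finset.sum_insert (by simp [Ne.symm hk, h1.symm, h3.symm]),
    Finset.sum_insert (by simp [h2.symm, h4.symm]), Finset.sum_pair (Ne.symm hl), h.neg,
    h.neg] at this
  linarith

theorem sum_sum_weight_le (h : IsSkewNormal A σ c) (hA : frobSq A ≤ 1) :
    ∑ k, ∑ l, (if l = k ∨ l = σ k then 0 else max 0 ((|c k| + |c l|) ^ 2 - 1 / 2)) ≤ 4 := by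
  set G : Fin n → Fin n → ℝ := fun k l =>
    if l = k ∨ l = σ k then 0 else max 0 ((|c k| + |c l|) ^ 2 - 1 / 2) with hG
  change ∑ k, ∑ l, G k l ≤ 4
  have habs : ∀ i, |c (σ i)| = |c i| := fun i => by rw [h.neg, abs_neg]
  have hsymm : ∀ k l, G k l = G l k := fun k l => by
    have e : (l = k ∨ l = σ k) ↔ (k = l ∨ k = σ l) := by
      refine or_congr eq_comm ⟨fun e => ?_, fun e => ?_⟩ <;> rw [e, h.invol]
    simp only [hG, e, add_comm |c k|]
  have hinv : ∀ k l, G (σ k) l = G k l := fun k l => by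
    have e : (l = σ k ∨ l = σ (σ k)) ↔ (l = k ∨ l = σ k) := by rw [h.invol k, or_comm]
    simp only [hG, e, habs]
  have hfix : ∀ k l, σ k = k → G k l = 0 := fun k l hk => by
    simp only [hG]
    split_ifs with e
    · rfl
    · push Not at e
      have := h.sum_sq_le hA e.1 e.2
      rw [h.eq_zero_of_fixed hk] at this ⊢
      rw [abs_zero, zero_add, sq_abs]
      exact max_eq_left (by linarith)
  have hrow : ∀ k, ∑ l, G k l = 2 * ∑ l with l < σ l, G k l := fun k =>
    h.invol.sum_eq_two_mul_sum_filter _ (fun l => by rw [hsymm, hinv, hsymm])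
      fun l hl => by rw [hsymm, hfix l k hl]
  have hsum : ∑ k, ∑ l, G k l =
      4 * ∑ k with k < σ k, ∑ l with l < σ l, G k l := by
    rw [h.invol.sum_eq_two_mul_sum_filter (fun k => ∑ l, G k l)
      (fun k => by simp only [hinv]) fun k hk => Finset.sum_eq_zero fun l _ => hfix k l hk]
    simp only [hrow, ← Finset.mul_sum]
    ring
  have hS : ∑ k with k < σ k, |c k| ^ 2 ≤ 1 / 2 := by
    have := h.invol.sum_eq_two_mul_sum_filter (fun k => |c k| ^ 2) (fun k => by simp only [habs])
      fun k hk => by rw [h.eq_zero_of_fixed hk]; norm_num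
    rw [h.frobSq_eq] at hA
    simp only [sq_abs] at this ⊢
    linarith
  have key := Finset.sum_sum_max_sq_add_le_one _ (fun k => |c k|) (fun k => abs_nonneg _) hS
  have hcongr : ∑ k with k < σ k, ∑ l with l < σ l, G k l =
      ∑ k with k < σ k, ∑ l with l < σ l,
        (if k = l then 0 else max 0 ((|c k| + |c l|) ^ 2 - 1 / 2)) := by
    refine Finset.sum_congr rfl fun k hk => Finset.sum_congr rfl fun l hl => ?_
    rw [Finset.mem_filter] at hk hl
    have e : (l = k ∨ l = σ k) ↔ k = l := by
      refine ⟨?_, fun e => Or.inl e.symm⟩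
      rintro (e | e)
      · exact e.symm
      · have h1 := hl.2
        rw [e, h.invol k] at h1
        exact absurd hk.2 h1.not_gt
    simp only [hG, e]
  rw [hsum, hcongr]
  linarith

end IsSkewNormal

theorem sq_add_sq_le_weight (a b x y : ℝ) (hab : a ^ 2 + b ^ 2 ≤ 1 / 2) :
    (a * x + b * y) ^ 2 + (a * y + b * x) ^ 2 - 1 / 2 * (x ^ 2 + y ^ 2) ≤
      max 0 ((|a| + |b|) ^ 2 - 1 / 2) * (1 / 2 * (x + (if 0 ≤ a * b then 1 else -1) * y) ^ 2) := by
  have h1 : (|a| + |b|) ^ 2 - 1 / 2 ≤ max 0 ((|a| + |b|) ^ 2 - 1 / 2) := le_max_right _ _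
  have h2 := mul_le_mul_of_nonneg_right h1
    (mul_nonneg (by norm_num : (0 : ℝ) ≤ 1 / 2)
      (sq_nonneg (x + (if 0 ≤ a * b then 1 else -1) * y)))
  refine le_trans ?_ h2
  have h3 : (|a| + |b|) ^ 2 = a ^ 2 + b ^ 2 + 2 * |a * b| := by
    rw [abs_mul]
    linear_combination sq_abs a + sq_abs b
  rw [h3]
  split_ifs with h
  · rw [abs_of_nonneg h]
    nlinarith [mul_nonneg h (sq_nonneg (x - y)),
      mul_nonneg (sub_nonneg.2 hab) (sq_nonneg (x - y))]
  · rw [abs_of_neg (not_le.1 h)]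
    nlinarith [mul_nonneg (neg_nonneg.2 (not_le.1 h).le) (sq_nonneg (x + y)),
      mul_nonneg (sub_nonneg.2 hab) (sq_nonneg (x + y))]

theorem frobInner_sum_smul {n m : ℕ} (J K : Finset (Fin m)) (p q : Fin m → ℝ)
    (b : Fin m → Matrix (Fin n) (Fin n) ℝ) :
    frobInner (∑ s ∈ J, p s • b s) (∑ t ∈ K, q t • b t) =
      ∑ s ∈ J, ∑ t ∈ K, p s * q t * frobInner (b s) (b t) := by
  simp only [frobInner_eq_trace, Matrix.transpose_sum, Matrix.transpose_smul, Matrix.sum_mul,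
    Matrix.mul_sum, Matrix.smul_mul, Matrix.mul_smul, Matrix.trace_sum, Matrix.trace_smul,
    smul_eq_mul]
  rw [Finset.sum_comm]
  refine Finset.sum_congr rfl fun t _ => ?_
  rw [Finset.mul_sum]
  exact Finset.sum_congr rfl fun s _ => by ring

theorem skew_conj {n : ℕ} (P : Matrix (Fin n) (Fin n) ℝ) {B : Matrix (Fin n) (Fin n) ℝ}
    (hB : Bᵀ = -B) : (Pᵀ * B * P)ᵀ = -(Pᵀ * B * P) := by
  simp only [Matrix.transpose_mul, Matrix.transpose_transpose, hB, Matrix.mul_neg, Matrix.neg_mul,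
    Matrix.mul_assoc]

theorem skew_apply {n : ℕ} {B : Matrix (Fin n) (Fin n) ℝ} (hB : Bᵀ = -B) (i j : Fin n) :
    B j i = -B i j := congrFun (congrFun hB i) j

theorem skew_diag {n : ℕ} {B : Matrix (Fin n) (Fin n) ℝ} (hB : Bᵀ = -B) (i : Fin n) :
    B i i = 0 := by
  linarith [skew_apply hB i i]

/-- Two independent entries of a skew-symmetric matrix account for twice their squares in the
Frobenius norm. -/
theorem two_mul_sq_add_sq_le_frobSq {n : ℕ} {V : Matrix (Fin n) (Fin n) ℝ} (hV : Vᵀ = -V)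
    {i j i' j' : Fin n} (hij : i ≠ j) (hij' : i' ≠ j') (h1 : (i, j) ≠ (i', j'))
    (h2 : (i, j) ≠ (j', i')) : 2 * (V i j ^ 2 + V i' j' ^ 2) ≤ frobSq V := by
  have e : frobSq V = ∑ p : Fin n × Fin n, V p.1 p.2 ^ 2 := by
    rw [Fintype.sum_prod_type]
    rfl
  have h3 : (j, i) ≠ (i', j') := fun h => h2 (by
    rw [Prod.mk.injEq] at h ⊢
    exact ⟨h.2, h.1⟩)
  have h4 : (j, i) ≠ (j', i') := fun h => h1 (by
    rw [Prod.mk.injEq] at h ⊢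
    exact ⟨h.2, h.1⟩)
  have h5 : (i, j) ≠ (j, i) := fun h => hij (congrArg Prod.fst h)
  have h6 : (i', j') ≠ (j', i') := fun h => hij' (congrArg Prod.fst h)
  have key : ∑ p ∈ ({(i, j), (j, i), (i', j'), (j', i')} : Finset (Fin n × Fin n)),
      V p.1 p.2 ^ 2 ≤ frobSq V := by
    rw [e]
    exact Finset.sum_le_sum_of_subset_of_nonneg (Finset.subset_univ _) fun _ _ _ => sq_nonneg _
  rw [Finset.sum_insert (by simp only [Finset.mem_insert, Finset.mem_singleton, not_or]; tauto),
    Finset.sum_insert (by simp only [Finset.mem_insert, Finset.mem_singleton, not_or]; tauto),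
    Finset.sum_pair h6] at key
  simp only [skew_apply hV i j, skew_apply hV i' j', neg_sq] at key
  linarith

/-- A family of pairwise orthogonal skew-symmetric matrices of norm at most one. -/
structure IsSkewSubunit {n m : ℕ} (b : Fin m → Matrix (Fin n) (Fin n) ℝ) : Prop where
  skew : ∀ s, (b s)ᵀ = -b s
  ortho : ∀ s t, s ≠ t → frobInner (b s) (b t) = 0
  le_one : ∀ s, frobSq (b s) ≤ 1

namespace IsSkewSubunit

variable {n m : ℕ} {b : Fin m → Matrix (Fin n) (Fin n) ℝ}

theorem conj (h : IsSkewSubunit b) {P : Matrix (Fin n) (Fin n) ℝ}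
    (hP : P ∈ Matrix.orthogonalGroup (Fin n) ℝ) : IsSkewSubunit fun s => Pᵀ * b s * P where
  skew s := skew_conj P (h.skew s)
  ortho s t hst := by rw [frobInner_conj hP, h.ortho s t hst]
  le_one s := by rw [frobSq_conj hP]; exact h.le_one s

theorem sum_sq_entries_le_one (h : IsSkewSubunit b) (J : Finset (Fin m)) {i j i' j' : Fin n}
    (hij : i ≠ j) (hij' : i' ≠ j') (h1 : (i, j) ≠ (i', j')) (h2 : (i, j) ≠ (j', i')) {ε : ℝ}
    (hε : ε ^ 2 = 1) : ∑ s ∈ J, (b s i j + ε * b s i' j') ^ 2 ≤ 1 := by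
  set q : Fin m → ℝ := fun s => b s i j + ε * b s i' j' with hq
  change ∑ s ∈ J, q s ^ 2 ≤ 1
  set V : Matrix (Fin n) (Fin n) ℝ := ∑ s ∈ J, q s • b s with hV
  have hVskew : Vᵀ = -V := by
    simp only [hV, Matrix.transpose_sum, Matrix.transpose_smul, h.skew, smul_neg,
      Finset.sum_neg_distrib]
  have hVnorm : frobSq V ≤ ∑ s ∈ J, q s ^ 2 := by
    rw [← frobInner_self, hV, frobInner_sum_smul]
    refine Finset.sum_le_sum fun s hs => ?_
    rw [Finset.sum_eq_single_of_mem s hs fun t _ hts => by rw [h.ortho s t hts.symm, mul_zero],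
      frobInner_self]
    nlinarith [h.le_one s, sq_nonneg (q s)]
  have hVq : V i j + ε * V i' j' = ∑ s ∈ J, q s ^ 2 := by
    simp only [hV, Matrix.sum_apply, Matrix.smul_apply, smul_eq_mul, Finset.mul_sum]
    rw [← Finset.sum_add_distrib]
    exact Finset.sum_congr rfl fun s _ => by simp only [hq]; ring
  have hlow := two_mul_sq_add_sq_le_frobSq hVskew hij hij' h1 h2
  have hsq : (∑ s ∈ J, q s ^ 2) ^ 2 ≤ ∑ s ∈ J, q s ^ 2 := by
    rw [← hVq] at hVnorm ⊢
    nlinarith [sq_nonneg (V i j - ε * V i' j')]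
  nlinarith

end IsSkewSubunit

theorem IsSkewNormal.sum_frobSq_matComm_le {n m : ℕ} {A : Matrix (Fin n) (Fin n) ℝ}
    {σ : Fin n → Fin n} {c : Fin n → ℝ} (h : IsSkewNormal A σ c) (hA : frobSq A ≤ 1)
    {b : Fin m → Matrix (Fin n) (Fin n) ℝ} (hb : IsSkewSubunit b) (J : Finset (Fin m)) :
    ∑ s ∈ J, (frobSq (matComm A (b s)) - 1 / 2 * frobSq (b s)) ≤ 1 := by
  have hG := h.sum_sum_weight_le hA
  set G : Fin n → Fin n → ℝ := fun k l =>
    if l = k ∨ l = σ k then 0 else max 0 ((|c k| + |c l|) ^ 2 - 1 / 2) with hGdef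
  change ∑ k, ∑ l, G k l ≤ 4 at hG
  let ε : Fin n → Fin n → ℝ := fun k l => if 0 ≤ c k * c l then 1 else -1
  have hε : ∀ k l, ε k l ^ 2 = 1 := fun k l => by
    simp only [ε]
    split_ifs <;> norm_num
  have hpt : ∀ s k l, (c k * b s (σ k) l + c l * b s k (σ l)) ^ 2 +
      (c k * b s k (σ l) + c l * b s (σ k) l) ^ 2 -
        1 / 2 * (b s (σ k) l ^ 2 + b s k (σ l) ^ 2) ≤
      G k l * (1 / 2 * (b s (σ k) l + ε k l * b s k (σ l)) ^ 2) := fun s k l => by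
    by_cases h1 : l = k
    · have e : b s k (σ k) = -b s (σ k) k := skew_apply (hb.skew s) _ _
      simp only [hGdef, h1, true_or, if_true, e]
      nlinarith [sq_nonneg (b s (σ k) k)]
    by_cases h2 : l = σ k
    · simp only [hGdef, h2, or_true, if_true, h.invol k, skew_diag (hb.skew s)]
      norm_num
    · simp only [hGdef, h1, h2, or_self, if_false]
      exact sq_add_sq_le_weight _ _ _ _ (h.sum_sq_le hA h1 h2)
  have hbessel : ∀ k l, G k l * ∑ s ∈ J, (1 / 2 * (b s (σ k) l + ε k l * b s k (σ l)) ^ 2) ≤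
      G k l * (1 / 2) := fun k l => by
    by_cases h1 : l = k ∨ l = σ k
    · simp [hGdef, h1]
    have hGnonneg : 0 ≤ G k l := by
      simp only [hGdef, h1, if_false]
      exact le_max_left _ _
    push Not at h1
    by_cases hk : σ k = k
    · have : G k l = 0 := by
        have hkl := h.sum_sq_le hA h1.1 h1.2
        simp only [hGdef, h1.1, h1.2, or_self, if_false]
        rw [h.eq_zero_of_fixed hk] at hkl ⊢
        rw [abs_zero, zero_add, sq_abs]
        exact max_eq_left (by linarith)
      rw [this, zero_mul, zero_mul]
    refine mul_le_mul_of_nonneg_left ?_ hGnonneg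
    rw [← Finset.mul_sum]
    have := hb.sum_sq_entries_le_one J (i := σ k) (j := l) (i' := k) (j' := σ l) h1.2.symm
      (fun e => h1.2 (by rw [e, h.invol l])) (fun e => hk (congrArg Prod.fst e))
      (fun e => h1.1 (congrArg Prod.snd e)) (hε k l)
    linarith
  have htwo : 2 * ∑ s ∈ J, (frobSq (matComm A (b s)) - 1 / 2 * frobSq (b s)) ≤ 2 := by
    calc 2 * ∑ s ∈ J, (frobSq (matComm A (b s)) - 1 / 2 * frobSq (b s))
        = ∑ s ∈ J, ∑ k, ∑ l, ((c k * b s (σ k) l + c l * b s k (σ l)) ^ 2 +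
            (c k * b s k (σ l) + c l * b s (σ k) l) ^ 2 -
              1 / 2 * (b s (σ k) l ^ 2 + b s k (σ l) ^ 2)) := by
          rw [Finset.mul_sum]
          refine Finset.sum_congr rfl fun s _ => ?_
          simp only [Finset.sum_sub_distrib, ← Finset.mul_sum, ← h.two_mul_frobSq,
            ← h.two_mul_frobSq_matComm]
          ring
      _ ≤ ∑ s ∈ J, ∑ k, ∑ l, G k l * (1 / 2 * (b s (σ k) l + ε k l * b s k (σ l)) ^ 2) :=
          Finset.sum_le_sum fun s _ => Finset.sum_le_sum fun k _ =>
            Finset.sum_le_sum fun l _ => hpt s k l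
      _ = ∑ k, ∑ l, G k l * ∑ s ∈ J, (1 / 2 * (b s (σ k) l + ε k l * b s k (σ l)) ^ 2) := by
          simp only [Finset.mul_sum]
          rw [Finset.sum_comm]
          exact Finset.sum_congr rfl fun k _ => Finset.sum_comm
      _ ≤ ∑ k, ∑ l, G k l * (1 / 2) :=
          Finset.sum_le_sum fun k _ => Finset.sum_le_sum fun l _ => hbessel k l
      _ ≤ 2 := by
          simp only [← Finset.sum_mul]
          linarith
  linarith

theorem exists_isSkewNormal {n : ℕ} (A : Matrix (Fin n) (Fin n) ℝ) (hA : Aᵀ = -A) :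
    ∃ P ∈ Matrix.orthogonalGroup (Fin n) ℝ, ∃ σ c, IsSkewNormal (Pᵀ * A * P) σ c := by
  obtain ⟨P, hP, σ, c, h1, h2, h3⟩ := A.exists_orthogonal_normal_form_of_skew hA
  exact ⟨P, hP, σ, c, h1, h2, h3⟩

theorem IsSkewSubunit.sum_frobSq_matComm_le {n m : ℕ} {b : Fin m → Matrix (Fin n) (Fin n) ℝ}
    (hb : IsSkewSubunit b) (r : Fin m) (J : Finset (Fin m)) :
    ∑ s ∈ J, (frobSq (matComm (b r) (b s)) - 1 / 2 * frobSq (b s)) ≤ 1 := by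
  obtain ⟨P, hP, σ, c, h⟩ := exists_isSkewNormal (b r) (hb.skew r)
  have := h.sum_frobSq_matComm_le ((hb.conj hP).le_one r) (hb.conj hP) J
  simpa only [matComm_conj hP, frobSq_conj hP] using this

theorem IsSkewNormal.term_nonneg {n : ℕ} {A : Matrix (Fin n) (Fin n) ℝ}
    {σ : Fin n → Fin n} {c : Fin n → ℝ} (h : IsSkewNormal A σ c) (hA : frobSq A ≤ 1)
    {B : Matrix (Fin n) (Fin n) ℝ} (hB : Bᵀ = -B) (k l : Fin n) :
    0 ≤ B (σ k) l ^ 2 + B k (σ l) ^ 2 - ((c k * B (σ k) l + c l * B k (σ l)) ^ 2 +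
      (c k * B k (σ l) + c l * B (σ k) l) ^ 2) := by
  by_cases h1 : l = k
  · have e : B k (σ k) = -B (σ k) k := skew_apply hB _ _
    simp only [h1, e]
    nlinarith [sq_nonneg (B (σ k) k)]
  by_cases h2 : l = σ k
  · simp only [h2, h.invol k, skew_diag hB]
    norm_num
  · have hkl := h.sum_sq_le hA h1 h2
    nlinarith [mul_nonneg (sub_nonneg.2 hkl) (add_nonneg (sq_nonneg (B (σ k) l))
      (sq_nonneg (B k (σ l)))), sq_nonneg (c k * B (σ k) l - c l * B k (σ l)),
      sq_nonneg (c k * B k (σ l) - c l * B (σ k) l)]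

theorem IsSkewNormal.two_mul_frobSq_sub {n : ℕ} {A : Matrix (Fin n) (Fin n) ℝ}
    {σ : Fin n → Fin n} {c : Fin n → ℝ} (h : IsSkewNormal A σ c) (B : Matrix (Fin n) (Fin n) ℝ) :
    2 * (frobSq B - frobSq (matComm A B)) =
      ∑ k, ∑ l, (B (σ k) l ^ 2 + B k (σ l) ^ 2 - ((c k * B (σ k) l + c l * B k (σ l)) ^ 2 +
      (c k * B k (σ l) + c l * B (σ k) l) ^ 2)) := by
  rw [mul_sub, h.two_mul_frobSq, h.two_mul_frobSq_matComm]
  simp only [← Finset.sum_sub_distrib]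

theorem frobSq_matComm_le {n : ℕ} {A B : Matrix (Fin n) (Fin n) ℝ} (hA : Aᵀ = -A) (hB : Bᵀ = -B)
    (hA1 : frobSq A ≤ 1) : frobSq (matComm A B) ≤ frobSq B := by
  obtain ⟨P, hP, σ, c, h⟩ := exists_isSkewNormal A hA
  have h1 := h.two_mul_frobSq_sub (Pᵀ * B * P)
  have h2 : 0 ≤ 2 * (frobSq (Pᵀ * B * P) - frobSq (matComm (Pᵀ * A * P) (Pᵀ * B * P))) := by
    rw [h1]
    exact Finset.sum_nonneg fun k _ => Finset.sum_nonneg fun l _ =>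
      h.term_nonneg (by rwa [frobSq_conj hP]) (skew_conj P hB) k l
  rw [matComm_conj hP, frobSq_conj hP, frobSq_conj hP] at h2
  linarith

theorem IsSkewNormal.entries_of_frobSq_matComm_eq {n : ℕ} {A : Matrix (Fin n) (Fin n) ℝ}
    {σ : Fin n → Fin n} {c : Fin n → ℝ} (h : IsSkewNormal A σ c) (hA : frobSq A ≤ 1)
    {B : Matrix (Fin n) (Fin n) ℝ} (hB : Bᵀ = -B) (hAB : frobSq (matComm A B) = frobSq B)
    (k l : Fin n) :
    c k * B (σ k) l = c l * B k (σ l) ∧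
      (B (σ k) l ≠ 0 → l ≠ k ∧ l ≠ σ k ∧ c k ^ 2 = 1 / 4 ∧ c l ^ 2 = 1 / 4) := by
  have h1 := h.two_mul_frobSq_sub B
  rw [hAB, sub_self, mul_zero] at h1
  have h2 := (Finset.sum_eq_zero_iff_of_nonneg fun l _ => h.term_nonneg hA hB k l).1
    ((Finset.sum_eq_zero_iff_of_nonneg fun k _ => Finset.sum_nonneg fun l _ =>
      h.term_nonneg hA hB k l).1 h1.symm k (Finset.mem_univ _)) l (Finset.mem_univ _)
  by_cases hlk : l = k
  · have e : B k (σ k) = -B (σ k) k := skew_apply hB _ _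
    simp only [hlk, e] at h2 ⊢
    have : B (σ k) k = 0 := by nlinarith [sq_nonneg (B (σ k) k)]
    simp [this]
  by_cases hlk' : l = σ k
  · simp [hlk', h.invol k, skew_diag hB]
  have hkl := h.sum_sq_le hA hlk hlk'
  set x := B (σ k) l
  set y := B k (σ l)
  set a := c k
  set b := c l
  have hm := mul_nonneg (sub_nonneg.2 hkl) (add_nonneg (sq_nonneg x) (sq_nonneg y))
  have e1 : (a * x - b * y) ^ 2 = 0 := by
    nlinarith [sq_nonneg (a * x - b * y), sq_nonneg (a * y - b * x)]
  have e2 : (a * y - b * x) ^ 2 = 0 := by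
    nlinarith [sq_nonneg (a * x - b * y), sq_nonneg (a * y - b * x)]
  have e3 : (1 / 2 - (a ^ 2 + b ^ 2)) * (x ^ 2 + y ^ 2) = 0 := by
    nlinarith [sq_nonneg (a * x - b * y), sq_nonneg (a * y - b * x)]
  have e1' : a * x - b * y = 0 := by simpa using e1
  have e2' : a * y - b * x = 0 := by simpa using e2
  refine ⟨by linarith, fun hx => ⟨hlk, hlk', ?_⟩⟩
  have hxy : x ^ 2 + y ^ 2 ≠ 0 := by positivity
  have e4 : 1 / 2 - (a ^ 2 + b ^ 2) = 0 := (mul_eq_zero.1 e3).resolve_right hxy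
  have e5 : a ^ 2 - b ^ 2 = 0 := by
    refine (mul_eq_zero.1 (?_ : (a ^ 2 - b ^ 2) * x = 0)).resolve_right hx
    linear_combination a * e1' + b * e2'
  constructor <;> linarith

theorem exists_perm_extending {n : ℕ} (hn : 4 ≤ n) {p : Fin 4 → Fin n}
    (hp : Function.Injective p) : ∃ π : Equiv.Perm (Fin n), ∀ i, π (Fin.castLE hn i) = p i := by
  let e : {x // x ∈ Set.range (Fin.castLE hn)} ≃ {x // x ∈ Set.range p} :=
    (Equiv.ofInjective _ (Fin.castLE_injective hn)).symm.trans (Equiv.ofInjective _ hp)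
  classical
  refine ⟨e.extendSubtype, fun i => ?_⟩
  rw [e.extendSubtype_apply_of_mem _ ⟨i, rfl⟩]
  change p ((Equiv.ofInjective _ (Fin.castLE_injective hn)).symm ⟨Fin.castLE hn i, ⟨i, rfl⟩⟩) = p i
  rw [Equiv.ofInjective_symm_apply (Fin.castLE_injective hn) i]

theorem submatrix_one_mem_orthogonalGroup {n : ℕ} (π : Equiv.Perm (Fin n)) :
    (1 : Matrix (Fin n) (Fin n) ℝ).submatrix id π ∈ Matrix.orthogonalGroup (Fin n) ℝ := by
  rw [Matrix.mem_orthogonalGroup_iff']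
  ext i j
  simp [Matrix.mul_apply, Matrix.one_apply]

theorem conj_submatrix_one {n : ℕ} (π : Equiv.Perm (Fin n)) (X : Matrix (Fin n) (Fin n) ℝ) :
    ((1 : Matrix (Fin n) (Fin n) ℝ).submatrix id π)ᵀ * X *
      (1 : Matrix (Fin n) (Fin n) ℝ).submatrix id π = X.submatrix π π := by
  ext i j
  simp [Matrix.mul_apply, Matrix.one_apply]

theorem submatrix_eq_diagBlock {n : ℕ} (hn : 4 ≤ n) {p : Fin 4 → Fin n}
    {π : Equiv.Perm (Fin n)} (hπ : ∀ i, π (Fin.castLE hn i) = p i)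
    {X : Matrix (Fin n) (Fin n) ℝ} (hX : ∀ i j, X i j ≠ 0 → i ∈ Set.range p ∧ j ∈ Set.range p) :
    X.submatrix π π = diagBlock n (X.submatrix p p) := by
  have hlt : ∀ i, π i ∈ Set.range p → (i : ℕ) < 4 := by
    rintro i ⟨j, hj⟩
    rw [← hπ] at hj
    rw [← π.injective hj]
    exact j.2
  ext i j
  simp only [diagBlock, Matrix.of_apply, Matrix.submatrix_apply]
  split_ifs with hi hj
  · rw [← hπ, ← hπ]
    rfl
  · by_contra h
    exact hj (hlt _ (hX _ _ h).2)
  · by_contra h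
    exact hi (hlt _ (hX _ _ h).1)

/-- Equality in the commutator estimate forces a simultaneous four-dimensional normal form. -/
theorem exists_conj_eq_diagBlock {n : ℕ} (hn : 4 ≤ n) {A B₀ : Matrix (Fin n) (Fin n) ℝ}
    (hA : Aᵀ = -A) (hA1 : frobSq A = 1) (hB₀ : B₀ᵀ = -B₀) (hB₀0 : B₀ ≠ 0)
    (hAB₀ : frobSq (matComm A B₀) = frobSq B₀) :
    ∃ P ∈ Matrix.orthogonalGroup (Fin n) ℝ, Pᵀ * A * P = diagBlock n (D1 (1 / 2)) ∧
      ∀ B : Matrix (Fin n) (Fin n) ℝ, Bᵀ = -B → frobSq (matComm A B) = frobSq B →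
        ∃ x y : ℝ, Pᵀ * B * P = diagBlock n (D2 x + D3 y) := by
  obtain ⟨P, hP, σ, c, h⟩ := exists_isSkewNormal A hA
  have hPP : P * Pᵀ = 1 := (Matrix.mem_orthogonalGroup_iff (Fin n) ℝ).1 hP
  have hA1' : frobSq (Pᵀ * A * P) = 1 := by rw [frobSq_conj hP, hA1]
  have hent : ∀ B : Matrix (Fin n) (Fin n) ℝ, Bᵀ = -B → frobSq (matComm A B) = frobSq B →
      ∀ k l, c k * (Pᵀ * B * P) (σ k) l = c l * (Pᵀ * B * P) k (σ l) ∧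
      ((Pᵀ * B * P) (σ k) l ≠ 0 → l ≠ k ∧ l ≠ σ k ∧ c k ^ 2 = 1 / 4 ∧ c l ^ 2 = 1 / 4) :=
    fun B hB hAB => h.entries_of_frobSq_matComm_eq hA1'.le (skew_conj P hB)
      (by rw [matComm_conj hP, frobSq_conj hP, frobSq_conj hP, hAB])
  obtain ⟨i₀, l₀, hil⟩ : ∃ i l, (Pᵀ * B₀ * P) i l ≠ 0 := by
    by_contra! hzero
    have hz : Pᵀ * B₀ * P = 0 := by
      ext i j
      exact hzero i j
    refine hB₀0 ?_
    calc B₀ = P * Pᵀ * B₀ * (P * Pᵀ) := by rw [hPP, Matrix.one_mul, Matrix.mul_one]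
      _ = P * (Pᵀ * B₀ * P) * Pᵀ := by simp only [Matrix.mul_assoc]
      _ = 0 := by rw [hz, Matrix.mul_zero, Matrix.zero_mul]
  obtain ⟨k₀, rfl⟩ := h.invol.surjective i₀
  obtain ⟨hlk, hlk', hck, hcl⟩ := (hent B₀ hB₀ hAB₀ k₀ l₀).2 hil
  have hpos : ∀ k, c k ^ 2 = 1 / 4 → ∃ a, (a = k ∨ a = σ k) ∧ c a = 1 / 2 := fun k hk => by
    rcases sq_eq_sq_iff_eq_or_eq_neg.1 (hk.trans (by norm_num : (1 / 4 : ℝ) = (1 / 2) ^ 2))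
      with e | e
    · exact ⟨k, Or.inl rfl, e⟩
    · exact ⟨σ k, Or.inr rfl, by rw [h.neg, e, neg_neg]⟩
  obtain ⟨a, ha, hca⟩ := hpos k₀ hck
  obtain ⟨b, hb, hcb⟩ := hpos l₀ hcl
  have hab : b ≠ a ∧ b ≠ σ a := by
    have e1 : σ l₀ ≠ k₀ := fun e => hlk' (by rw [← e, h.invol])
    have e2 : σ l₀ ≠ σ k₀ := fun e => hlk (h.invol.injective e)
    rcases ha with rfl | rfl <;> rcases hb with rfl | rfl <;> simp [h.invol _, *]
  obtain ⟨hba, hba'⟩ := hab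
  have hsa : c (σ a) = -(1 / 2) := by rw [h.neg, hca]
  have hsb : c (σ b) = -(1 / 2) := by rw [h.neg, hcb]
  have haa : σ a ≠ a := fun e => by rw [e, hca] at hsa; norm_num at hsa
  have hbb : σ b ≠ b := fun e => by rw [e, hcb] at hsb; norm_num at hsb
  have hab1 : σ b ≠ a := fun e => hba' (by rw [← e, h.invol])
  have hab2 : σ b ≠ σ a := fun e => hba (h.invol.injective e)
  let p : Fin 4 → Fin n := ![σ a, a, σ b, b]
  have hp : Function.Injective p := by
    intro i j hij
    fin_cases i <;> fin_cases j <;> first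
      | rfl
      | (exfalso
         simp [p] at hij
         first
          | exact haa hij | exact haa hij.symm | exact hbb hij | exact hbb hij.symm
          | exact hab1 hij | exact hab1 hij.symm | exact hab2 hij | exact hab2 hij.symm
          | exact hba hij | exact hba hij.symm | exact hba' hij | exact hba' hij.symm)
  have hsupp : ∀ i, c i ≠ 0 → i ∈ Set.range p := fun i hi => by
    by_contra hip
    have hi4 : i ≠ σ a ∧ i ≠ a ∧ i ≠ σ b ∧ i ≠ b :=
      ⟨fun e => hip ⟨0, e.symm⟩, fun e => hip ⟨1, e.symm⟩, fun e => hip ⟨2, e.symm⟩,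
        fun e => hip ⟨3, e.symm⟩⟩
    have hsum : ∑ j ∈ ({i, σ a, a, σ b, b} : Finset (Fin n)), c j ^ 2 ≤ 1 := by
      rw [← hA1', h.frobSq_eq]
      exact Finset.sum_le_sum_of_subset_of_nonneg (Finset.subset_univ _) fun _ _ _ => sq_nonneg _
    rw [Finset.sum_insert (by simp [hi4]),
      Finset.sum_insert (by simp [haa, hba'.symm, hab2.symm]),
      Finset.sum_insert (by simp [hba.symm, hab1.symm]), Finset.sum_pair hbb, hsa, hca, hsb,
      hcb] at hsum
    have : 0 < c i ^ 2 := by positivity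
    linarith
  obtain ⟨π, hπ⟩ := exists_perm_extending hn hp
  refine ⟨P * (1 : Matrix (Fin n) (Fin n) ℝ).submatrix id π,
    mul_mem hP (submatrix_one_mem_orthogonalGroup π), ?_, fun B hB hAB => ?_⟩
  · have e : (P * (1 : Matrix (Fin n) (Fin n) ℝ).submatrix id π)ᵀ * A *
        (P * (1 : Matrix (Fin n) (Fin n) ℝ).submatrix id π) =
        (Pᵀ * A * P).submatrix π π := by
      rw [← conj_submatrix_one, Matrix.transpose_mul]
      simp only [Matrix.mul_assoc]
    rw [e, submatrix_eq_diagBlock hn hπ]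
    · congr 1
      ext i j
      fin_cases i <;> fin_cases j <;>
        simp [D1, p, h.apply, h.invol _, hca, hsa, hcb, hsb, haa, hbb, hab1, hab2, hba, hba',
          haa.symm, hbb.symm, hab1.symm, hab2.symm, hba.symm, hba'.symm]
    · intro i j hij
      rw [h.apply] at hij
      have hi : i = σ j := by
        by_contra e
        exact hij (if_neg e)
      rw [if_pos hi] at hij
      exact ⟨hsupp i (by rw [hi, h.neg]; exact neg_ne_zero.2 hij), hsupp j hij⟩
  · set X := Pᵀ * B * P with hX
    have hXs : Xᵀ = -X := skew_conj P hB
    have hXent := hent B hB hAB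
    have e : (P * (1 : Matrix (Fin n) (Fin n) ℝ).submatrix id π)ᵀ * B *
        (P * (1 : Matrix (Fin n) (Fin n) ℝ).submatrix id π) = X.submatrix π π := by
      rw [← conj_submatrix_one, Matrix.transpose_mul]
      simp only [hX, Matrix.mul_assoc]
    refine ⟨X (σ a) (σ b), X (σ a) b, ?_⟩
    rw [e, submatrix_eq_diagBlock hn hπ]
    · congr 1
      have z1 : X (σ a) a = 0 := by
        by_contra hne
        exact ((hXent a a).2 hne).1 rfl
      have z2 : X (σ b) b = 0 := by
        by_contra hne
        exact ((hXent b b).2 hne).1 rfl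
      have y1 : X a (σ b) = X (σ a) b := by
        have := (hXent a b).1
        rw [hca, hcb] at this
        linarith
      have y2 : X a b = -X (σ a) (σ b) := by
        have := (hXent a (σ b)).1
        rw [hca, hsb, h.invol b] at this
        linarith
      ext i j
      fin_cases i <;> fin_cases j <;>
        simp [D2, D3, p, skew_diag hXs, skew_apply hXs (σ a), skew_apply hXs a (σ b),
          skew_apply hXs a b, skew_apply hXs (σ b) b, z1, z2, y1, y2]
    · intro i j hij
      obtain ⟨k, rfl⟩ := h.invol.surjective i
      obtain ⟨-, -, h3, h4⟩ := (hXent k j).2 hij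
      refine ⟨hsupp _ ?_, hsupp _ ?_⟩
      · intro e0
        rw [h.neg, neg_eq_zero] at e0
        rw [e0] at h3
        norm_num at h3
      · intro e0
        rw [e0] at h4
        norm_num at h4

theorem diagBlock_castAdd_castAdd {j : ℕ} (D : Matrix (Fin 4) (Fin 4) ℝ) (a b : Fin 4) :
    diagBlock (4 + j) D (Fin.castAdd j a) (Fin.castAdd j b) = D a b := by
  simp [diagBlock]

theorem diagBlock_natAdd_left {j : ℕ} (D : Matrix (Fin 4) (Fin 4) ℝ) (a : Fin j)
    (b : Fin (4 + j)) : diagBlock (4 + j) D (Fin.natAdd 4 a) b = 0 := by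
  simp [diagBlock]

theorem diagBlock_natAdd_right {j : ℕ} (D : Matrix (Fin 4) (Fin 4) ℝ) (a : Fin (4 + j))
    (b : Fin j) : diagBlock (4 + j) D a (Fin.natAdd 4 b) = 0 := by
  simp [diagBlock]

theorem frobInner_diagBlock {n : ℕ} (hn : 4 ≤ n) (D D' : Matrix (Fin 4) (Fin 4) ℝ) :
    frobInner (diagBlock n D) (diagBlock n D') = frobInner D D' := by
  obtain ⟨j, rfl⟩ := Nat.exists_eq_add_of_le hn
  simp only [frobInner, Fin.sum_univ_add, diagBlock_castAdd_castAdd, diagBlock_natAdd_left,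
    diagBlock_natAdd_right, mul_zero, Finset.sum_const_zero, add_zero]

theorem frobSq_diagBlock {n : ℕ} (hn : 4 ≤ n) (D : Matrix (Fin 4) (Fin 4) ℝ) :
    frobSq (diagBlock n D) = frobSq D := by
  rw [← frobInner_self, frobInner_diagBlock hn, frobInner_self]

theorem diagBlock_add {n : ℕ} (D D' : Matrix (Fin 4) (Fin 4) ℝ) :
    diagBlock n (D + D') = diagBlock n D + diagBlock n D' := by
  ext i j
  simp only [diagBlock, Matrix.of_apply, Matrix.add_apply]
  split_ifs <;> simp

theorem diagBlock_smul {n : ℕ} (t : ℝ) (D : Matrix (Fin 4) (Fin 4) ℝ) :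
    diagBlock n (t • D) = t • diagBlock n D := by
  ext i j
  simp only [diagBlock, Matrix.of_apply, Matrix.smul_apply]
  split_ifs <;> simp

theorem diagBlock_zero {n : ℕ} : diagBlock n 0 = 0 := by
  simpa using diagBlock_smul (n := n) 0 0

theorem matComm_diagBlock {n : ℕ} (hn : 4 ≤ n) (D D' : Matrix (Fin 4) (Fin 4) ℝ) :
    matComm (diagBlock n D) (diagBlock n D') = diagBlock n (matComm D D') := by
  obtain ⟨j, rfl⟩ := Nat.exists_eq_add_of_le hn
  ext a b
  refine Fin.addCases (fun a => ?_) (fun a => ?_) a <;>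
    refine Fin.addCases (fun b => ?_) (fun b => ?_) b <;>
    simp [matComm, Matrix.mul_apply, Fin.sum_univ_add, diagBlock_castAdd_castAdd,
      diagBlock_natAdd_left, diagBlock_natAdd_right]

theorem D1_mul (t l : ℝ) : D1 (t * l) = t • D1 l := by
  ext i j
  fin_cases i <;> fin_cases j <;> simp [D1]

theorem D2_mul (t l : ℝ) : D2 (t * l) = t • D2 l := by
  ext i j
  fin_cases i <;> fin_cases j <;> simp [D2]

theorem D3_mul (t l : ℝ) : D3 (t * l) = t • D3 l := by
  ext i j
  fin_cases i <;> fin_cases j <;> simp [D3]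

theorem D1_zero : D1 0 = 0 := by simpa using D1_mul 0 0

theorem D2_zero : D2 0 = 0 := by simpa using D2_mul 0 0

theorem D3_zero : D3 0 = 0 := by simpa using D3_mul 0 0

theorem frobSq_D (l : ℝ) :
    frobSq (D1 l) = 4 * l ^ 2 ∧ frobSq (D2 l) = 4 * l ^ 2 ∧ frobSq (D3 l) = 4 * l ^ 2 := by
  refine ⟨?_, ?_, ?_⟩ <;> simp [frobSq, D1, D2, D3, Fin.sum_univ_four] <;> ring

theorem frobInner_D2_add_D3 (x y z w : ℝ) :
    frobInner (D2 x + D3 y) (D2 z + D3 w) = 4 * (x * z + y * w) := by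
  simp [frobInner, D2, D3, Fin.sum_univ_four]
  ring

theorem frobSq_matComm_D (l : ℝ) : frobSq (matComm (D1 l) (D2 l)) = 16 * l ^ 4 ∧
    frobSq (matComm (D1 l) (D3 l)) = 16 * l ^ 4 ∧
    frobSq (matComm (D2 l) (D3 l)) = 16 * l ^ 4 := by
  refine ⟨?_, ?_, ?_⟩ <;>
    simp [frobSq, matComm, D1, D2, D3, Fin.sum_univ_four] <;> ring

theorem matComm_self {n : ℕ} (A : Matrix (Fin n) (Fin n) ℝ) : matComm A A = 0 := sub_self _

theorem frobSq_zero {n : ℕ} : frobSq (0 : Matrix (Fin n) (Fin n) ℝ) = 0 := by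
  simp [frobSq]

theorem frobSq_smul {n : ℕ} (t : ℝ) (A : Matrix (Fin n) (Fin n) ℝ) :
    frobSq (t • A) = t ^ 2 * frobSq A := by
  simp only [frobSq, Matrix.smul_apply, smul_eq_mul, mul_pow, Finset.mul_sum]

theorem frobSq_nonneg {n : ℕ} (A : Matrix (Fin n) (Fin n) ℝ) : 0 ≤ frobSq A :=
  Finset.sum_nonneg fun _ _ => Finset.sum_nonneg fun _ _ => sq_nonneg _

theorem frobSq_eq_zero_iff {n : ℕ} {A : Matrix (Fin n) (Fin n) ℝ} : frobSq A = 0 ↔ A = 0 := by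
  refine ⟨fun h => ?_, fun h => by rw [h, frobSq_zero]⟩
  ext i j
  have h1 := (Finset.sum_eq_zero_iff_of_nonneg fun i _ => Finset.sum_nonneg fun j _ =>
    sq_nonneg (A i j)).1 h i (Finset.mem_univ _)
  have h2 := (Finset.sum_eq_zero_iff_of_nonneg fun j _ => sq_nonneg (A i j)).1 h1 j
    (Finset.mem_univ _)
  simpa using h2

theorem frobSq_matComm_comm {n : ℕ} (A B : Matrix (Fin n) (Fin n) ℝ) :
    frobSq (matComm A B) = frobSq (matComm B A) := by
  have : matComm A B = (-1 : ℝ) • matComm B A := by simp [matComm]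
  rw [this, frobSq_smul]
  norm_num

theorem matComm_smul_smul {n : ℕ} (s t : ℝ) (A B : Matrix (Fin n) (Fin n) ℝ) :
    matComm (s • A) (t • B) = (s * t) • matComm A B := by
  simp only [matComm, Matrix.smul_mul, Matrix.mul_smul, smul_smul, smul_sub, mul_comm t s]

/-- The model tuple `(diag(D₁, 0), diag(D₂, 0), diag(D₃, 0), 0, …, 0)`. -/
def modelTuple (n m : ℕ) (l : ℝ) (s : Fin m) : Matrix (Fin n) (Fin n) ℝ :=
  if (s : ℕ) = 0 then diagBlock n (D1 l)
  else if (s : ℕ) = 1 then diagBlock n (D2 l)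
  else if (s : ℕ) = 2 then diagBlock n (D3 l)
  else 0

theorem modelTuple_natAdd (n k : ℕ) (l : ℝ) (j : Fin k) :
    modelTuple n (3 + k) l (Fin.natAdd 3 j) = 0 := by
  simp only [modelTuple, Fin.val_natAdd]
  rw [if_neg (by omega), if_neg (by omega), if_neg (by omega)]

theorem modelTuple_equality {n m : ℕ} (hn : 4 ≤ n) (hm : 3 ≤ m) (l : ℝ) :
    ∑ r, ∑ s, frobSq (matComm (modelTuple n m l r) (modelTuple n m l s)) =
      (2 / 3) * (∑ r, frobSq (modelTuple n m l r)) ^ 2 := by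
  obtain ⟨k, rfl⟩ := Nat.exists_eq_add_of_le hm
  have h0 : modelTuple n (3 + k) l (Fin.castAdd k 0) = diagBlock n (D1 l) := rfl
  have h1 : modelTuple n (3 + k) l (Fin.castAdd k 1) = diagBlock n (D2 l) := rfl
  have h2 : modelTuple n (3 + k) l (Fin.castAdd k 2) = diagBlock n (D3 l) := rfl
  have z1 : ∀ X : Matrix (Fin n) (Fin n) ℝ, matComm X 0 = 0 := fun X => by simp [matComm]
  have z2 : ∀ X : Matrix (Fin n) (Fin n) ℝ, matComm 0 X = 0 := fun X => by simp [matComm]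
  obtain ⟨f1, f2, f3⟩ := frobSq_D l
  obtain ⟨g1, g2, g3⟩ := frobSq_matComm_D l
  simp only [Fin.sum_univ_add, Fin.sum_univ_three, h0, h1, h2, modelTuple_natAdd, z1, z2,
    matComm_diagBlock hn, frobSq_diagBlock hn, frobSq_zero, Finset.sum_const_zero, add_zero,
    matComm_self, f1, f2, f3, g1, g2, g3, frobSq_matComm_comm (D2 l) (D1 l),
    frobSq_matComm_comm (D3 l) (D1 l), frobSq_matComm_comm (D3 l) (D2 l)]
  ring

theorem exists_rotation_orthogonal {n m : ℕ} (B : Fin m → Matrix (Fin n) (Fin n) ℝ) :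
    ∃ R ∈ Matrix.orthogonalGroup (Fin m) ℝ,
      (∀ s t, s ≠ t → frobInner (∑ r, R r s • B r) (∑ r, R r t • B r) = 0) ∧
      Antitone fun s => frobSq (∑ r, R r s • B r) := by
  let G : Matrix (Fin m) (Fin m) ℝ := Matrix.of fun r s => frobInner (B r) (B s)
  have hG : G.IsHermitian := by
    ext r s
    simp [G, frobInner, mul_comm]
  let U : Matrix (Fin m) (Fin m) ℝ := hG.eigenvectorUnitary
  have hU : U ∈ Matrix.orthogonalGroup (Fin m) ℝ := hG.eigenvectorUnitary.2
  have hUG : Uᵀ * G * U = Matrix.diagonal hG.eigenvalues := by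
    have := hG.conjStarAlgAut_star_eigenvectorUnitary
    simp only [Unitary.conjStarAlgAut_apply] at this
    simp at this
    rw [Matrix.star_eq_conjTranspose, Matrix.conjTranspose_eq_transpose_of_trivial] at this
    exact this
  have hin : ∀ s t, frobInner (∑ r, U r s • B r) (∑ r, U r t • B r) =
      (Uᵀ * G * U) s t := fun s t => by
    rw [frobInner_sum_smul, Matrix.mul_assoc]
    simp only [Matrix.mul_apply, Matrix.transpose_apply, Finset.mul_sum, G, Matrix.of_apply]
    exact Finset.sum_congr rfl fun r _ => Finset.sum_congr rfl fun q _ => by ring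
  let f : Fin m → ℝ := fun s => -frobSq (∑ r, U r s • B r)
  let π := Tuple.sort f
  refine ⟨U * (1 : Matrix (Fin m) (Fin m) ℝ).submatrix id π,
    mul_mem hU (submatrix_one_mem_orthogonalGroup π), ?_⟩
  have hentry : ∀ r s, (U * (1 : Matrix (Fin m) (Fin m) ℝ).submatrix id π) r s = U r (π s) :=
    fun r s => by simp [Matrix.mul_apply, Matrix.one_apply]
  simp only [hentry]
  refine ⟨fun s t hst => ?_, fun s t hst => ?_⟩
  · rw [hin, hUG, Matrix.diagonal_apply_ne _ (fun e => hst (π.injective e))]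
  · have := Tuple.monotone_sort f hst
    simpa [f] using this

theorem sum_mul_le_half_add {m : ℕ} {x a : Fin m → ℝ} {r u v : Fin m} (hru : u ≠ r)
    (hx : ∀ s, 0 ≤ x s) (ha : ∀ s, a s ≤ 1) (har : a r = 0)
    (hJ : ∀ J : Finset (Fin m), ∑ s ∈ J, (a s - 1 / 2) ≤ 1)
    (huv : x v ≤ x u) (hv : ∀ s, s ≠ u → s ≠ r → x s ≤ x v) :
    ∑ s, x s * a s ≤ 1 / 2 * (∑ s, x s - x r) + 1 / 2 * (x u + x v) := by
  classical
  let d : Fin m → ℝ := fun s => max 0 (a s - 1 / 2)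
  have hd0 : ∀ s, 0 ≤ d s := fun s => le_max_left _ _
  have hd1 : ∀ s, d s ≤ 1 / 2 := fun s => max_le (by norm_num) (by linarith [ha s])
  have hdr : d r = 0 := by simp [d, har]
  have hda : ∀ s, a s - 1 / 2 ≤ d s := fun s => le_max_right _ _
  have hd : ∑ s, d s ≤ 1 := by
    refine le_trans (le_of_eq ?_) (hJ (Finset.univ.filter fun s => 0 < a s - 1 / 2))
    rw [Finset.sum_filter]
    refine Finset.sum_congr rfl fun s _ => ?_
    split_ifs with h
    · exact max_eq_right h.le
    · exact max_eq_left (not_lt.1 h)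
  have h1 : ∀ s, x s * a s ≤ (1 / 2 * x s - if s = r then 1 / 2 * x r else 0) +
      (x v * d s + if s = u then 1 / 2 * (x u - x v) else 0) := fun s => by
    by_cases hs : s = r
    · subst hs
      rw [if_pos rfl, if_neg hru.symm, har, hdr]
      linarith
    · rw [if_neg hs]
      have e : x s * a s ≤ 1 / 2 * x s + x s * d s := by nlinarith [hx s, hda s]
      by_cases hu : s = u
      · subst hu
        rw [if_pos rfl]
        nlinarith [hd1 s]
      · rw [if_neg hu]
        nlinarith [hv s hu hs, hd0 s]
  refine (Finset.sum_le_sum fun s _ => h1 s).trans ?_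
  rw [Finset.sum_add_distrib, Finset.sum_add_distrib, Finset.sum_sub_distrib, ← Finset.mul_sum,
    ← Finset.mul_sum, Finset.sum_ite_eq' Finset.univ r, Finset.sum_ite_eq' Finset.univ u,
    if_pos (Finset.mem_univ _), if_pos (Finset.mem_univ _)]
  nlinarith [hx v]

theorem eq_of_weighted_sum_eq {k : ℕ} {x : Fin (3 + k) → ℝ} {a : Fin (3 + k) → Fin (3 + k) → ℝ}
    (hx : ∀ s, 0 ≤ x s) (hanti : Antitone x) (ha : ∀ r s, a r s ≤ 1) (har : ∀ r, a r r = 0)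
    (hsymm : ∀ r s, a r s = a s r)
    (hJ : ∀ r, ∀ J : Finset (Fin (3 + k)), ∑ s ∈ J, (a r s - 1 / 2) ≤ 1)
    (heq : ∑ r, ∑ s, x r * x s * a r s = 2 / 3 * (∑ r, x r) ^ 2) :
    x (Fin.castAdd k 1) = x (Fin.castAdd k 0) ∧ x (Fin.castAdd k 2) = x (Fin.castAdd k 0) ∧
      (∀ j, x (Fin.natAdd 3 j) = 0) ∧ (x (Fin.castAdd k 0) ≠ 0 →
        a (Fin.castAdd k 0) (Fin.castAdd k 1) = 1 ∧
        a (Fin.castAdd k 0) (Fin.castAdd k 2) = 1) := by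
  have hle : ∀ {s t : Fin (3 + k)}, (s : ℕ) ≤ t → x t ≤ x s := fun h => hanti h
  have v0 : ((Fin.castAdd k (0 : Fin 3) : Fin (3 + k)) : ℕ) = 0 := rfl
  have v1 : ((Fin.castAdd k (1 : Fin 3) : Fin (3 + k)) : ℕ) = 1 := rfl
  have v2 : ((Fin.castAdd k (2 : Fin 3) : Fin (3 + k)) : ℕ) = 2 := rfl
  set i0 : Fin (3 + k) := Fin.castAdd k 0
  set i1 : Fin (3 + k) := Fin.castAdd k 1
  set i2 : Fin (3 + k) := Fin.castAdd k 2
  set X := ∑ r, x r with hX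
  have hXs : X = x i0 + x i1 + x i2 + ∑ j, x (Fin.natAdd 3 j) := by
    rw [hX, Fin.sum_univ_add, Fin.sum_univ_three]
  have n10 : i1 ≠ i0 := fun h => by rw [Fin.ext_iff] at h; omega
  have top : ∀ r, r ≠ i0 → r ≠ i1 → ∑ s, x s * a r s ≤
      1 / 2 * (X - x r) + 1 / 2 * (x i0 + x i1) := fun r h0 h1 =>
    sum_mul_le_half_add h0.symm hx (ha r) (har r) (hJ r) (hle (by omega)) fun s hs _ =>
      hle (by rw [Ne, Fin.ext_iff] at hs; omega)
  have row0 : ∑ s, x s * a i0 s ≤ 1 / 2 * (X - x i0) + 1 / 2 * (x i1 + x i2) :=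
    sum_mul_le_half_add n10 hx (ha i0) (har i0) (hJ i0) (hle (by omega)) fun s hs hs' =>
      hle (by rw [Ne, Fin.ext_iff] at hs hs'; omega)
  have row1 : ∑ s, x s * a i1 s ≤ 1 / 2 * (X - x i1) + 1 / 2 * (x i0 + x i2) :=
    sum_mul_le_half_add n10.symm hx (ha i1) (har i1) (hJ i1) (hle (by omega)) fun s hs hs' =>
      hle (by rw [Ne, Fin.ext_iff] at hs hs'; omega)
  have row2 := top i2 (fun h => by rw [Fin.ext_iff] at h; omega)
    (fun h => by rw [Fin.ext_iff] at h; omega)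
  have rowj : ∀ j, x (Fin.natAdd 3 j) * ∑ s, x s * a (Fin.natAdd 3 j) s ≤
      x (Fin.natAdd 3 j) * (1 / 2 * X + 1 / 2 * (x i0 + x i1)) := fun j => by
    have vj : ((Fin.natAdd 3 j : Fin (3 + k)) : ℕ) = 3 + j := rfl
    have := top (Fin.natAdd 3 j) (fun h => by rw [Fin.ext_iff] at h; omega)
      (fun h => by rw [Fin.ext_iff] at h; omega)
    exact mul_le_mul_of_nonneg_left (by linarith [hx (Fin.natAdd 3 j)]) (hx _)
  have hF : ∑ r, x r * ∑ s, x s * a r s = 2 / 3 * X ^ 2 := by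
    rw [← heq]
    simp only [Finset.mul_sum, mul_assoc]
  have hF2 := hF
  rw [Fin.sum_univ_add, Fin.sum_univ_three] at hF2
  have tail := Finset.sum_le_sum fun j (_ : j ∈ Finset.univ) => rowj j
  rw [← Finset.sum_mul] at tail
  have e0 := mul_le_mul_of_nonneg_left row0 (hx i0)
  have e1 := mul_le_mul_of_nonneg_left row1 (hx i1)
  have e2 := mul_le_mul_of_nonneg_left row2 (hx i2)
  have hT : ∑ j, x (Fin.natAdd 3 j) = X - x i0 - x i1 - x i2 := by linarith
  rw [hT] at tail
  have key : 1 / 3 * (X - 3 / 2 * (x i0 + x i1)) ^ 2 + (x i0 - x i1) ^ 2 +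
      (x i2 - (x i0 + x i1) / 2) ^ 2 ≤ 0 := by
    nlinarith only [e0, e1, e2, tail, hF2]
  have q1 := sq_nonneg (X - 3 / 2 * (x i0 + x i1))
  have q2 := sq_nonneg (x i0 - x i1)
  have q3 := sq_nonneg (x i2 - (x i0 + x i1) / 2)
  have s1 : X - 3 / 2 * (x i0 + x i1) = 0 := (pow_eq_zero_iff two_ne_zero).1 (by linarith)
  have s2 : x i0 - x i1 = 0 := (pow_eq_zero_iff two_ne_zero).1 (by linarith)
  have s3 : x i2 - (x i0 + x i1) / 2 = 0 := (pow_eq_zero_iff two_ne_zero).1 (by linarith)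
  have x1 : x i1 = x i0 := by linarith
  have x2 : x i2 = x i0 := by linarith
  have hz : ∀ j, x (Fin.natAdd 3 j) = 0 := fun j =>
    (Finset.sum_eq_zero_iff_of_nonneg fun j _ => hx (Fin.natAdd 3 j)).1
      (by linarith) j (Finset.mem_univ j)
  refine ⟨x1, x2, hz, fun h0 => ?_⟩
  simp only [Fin.sum_univ_add, Fin.sum_univ_three, hz, zero_mul,
    Finset.sum_const_zero, add_zero] at hF
  change x i0 * (x i0 * a i0 i0 + x i1 * a i0 i1 + x i2 * a i0 i2) +
    x i1 * (x i0 * a i1 i0 + x i1 * a i1 i1 + x i2 * a i1 i2) +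
    x i2 * (x i0 * a i2 i0 + x i1 * a i2 i1 + x i2 * a i2 i2) = 2 / 3 * X ^ 2 at hF
  have hX3 : X = 3 * x i0 := by linarith
  rw [x1, x2, har, har, har, hsymm i1 i0, hsymm i2 i0, hsymm i2 i1, hX3] at hF
  have hs : a i0 i1 + a i0 i2 + a i1 i2 = 3 :=
    mul_left_cancel₀ (pow_ne_zero 2 h0) (by linarith)
  constructor <;> linarith [ha i0 i1, ha i0 i2, ha i1 i2]

/-- The block-diagonal extension of a `3 × 3` matrix by an identity block. -/
def extendOne {k : ℕ} (M : Matrix (Fin 3) (Fin 3) ℝ) : Matrix (Fin (3 + k)) (Fin (3 + k)) ℝ :=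
  (Matrix.fromBlocks M 0 0 1).submatrix finSumFinEquiv.symm finSumFinEquiv.symm

theorem extendOne_mem_orthogonalGroup {k : ℕ} {M : Matrix (Fin 3) (Fin 3) ℝ}
    (hM : M * Mᵀ = 1) :
    extendOne (k := k) M ∈ Matrix.orthogonalGroup (Fin (3 + k)) ℝ := by
  rw [Matrix.mem_orthogonalGroup_iff, extendOne, Matrix.transpose_submatrix,
    Matrix.submatrix_mul_equiv, Matrix.fromBlocks_transpose, Matrix.fromBlocks_multiply]
  simp [hM]

theorem sum_extendOne_castAdd {n k : ℕ} (M : Matrix (Fin 3) (Fin 3) ℝ)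
    (V : Fin (3 + k) → Matrix (Fin n) (Fin n) ℝ) (i : Fin 3) :
    ∑ q, extendOne M q (Fin.castAdd k i) • V q =
      M 0 i • V (Fin.castAdd k 0) + M 1 i • V (Fin.castAdd k 1) + M 2 i • V (Fin.castAdd k 2) := by
  simp [extendOne, Fin.sum_univ_add, Fin.sum_univ_three]

theorem sum_extendOne_natAdd {n k : ℕ} (M : Matrix (Fin 3) (Fin 3) ℝ)
    (V : Fin (3 + k) → Matrix (Fin n) (Fin n) ℝ) (j : Fin k) :
    ∑ q, extendOne M q (Fin.natAdd 3 j) • V q = V (Fin.natAdd 3 j) := by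
  simp [extendOne, Fin.sum_univ_add, Matrix.one_apply]

theorem sum_mul_smul_conj {n m : ℕ} (R S : Matrix (Fin m) (Fin m) ℝ)
    (P : Matrix (Fin n) (Fin n) ℝ) (B : Fin m → Matrix (Fin n) (Fin n) ℝ) (s : Fin m) :
    ∑ r, (R * S) r s • (Pᵀ * B r * P) = ∑ q, S q s • (Pᵀ * (∑ r, R r q • B r) * P) := by
  simp only [Matrix.mul_apply, Finset.sum_smul, Matrix.mul_sum, Matrix.sum_mul, Finset.smul_sum,
    Matrix.mul_smul, Matrix.smul_mul, smul_smul]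
  rw [Finset.sum_comm]
  exact Finset.sum_congr rfl fun q _ => Finset.sum_congr rfl fun r _ => by rw [mul_comm]

/-- A tuple whose first three members are `diag(D₁, 0)` and two orthogonal combinations of
`diag(D₂, 0)` and `diag(D₃, 0)`, and whose other members vanish, can be rotated to the
model tuple. -/
theorem exists_rotation_modelTuple {n k : ℕ} {l x y z w : ℝ} (hl : l ≠ 0)
    (hxy : x ^ 2 + y ^ 2 = l ^ 2) (hzw : z ^ 2 + w ^ 2 = l ^ 2) (hxz : x * z + y * w = 0)
    {V : Fin (3 + k) → Matrix (Fin n) (Fin n) ℝ}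
    (h0 : V (Fin.castAdd k 0) = diagBlock n (D1 l))
    (h1 : V (Fin.castAdd k 1) = diagBlock n (D2 x + D3 y))
    (h2 : V (Fin.castAdd k 2) = diagBlock n (D2 z + D3 w))
    (hV : ∀ j, V (Fin.natAdd 3 j) = 0) :
    ∃ R ∈ Matrix.orthogonalGroup (Fin (3 + k)) ℝ,
      ∀ s, ∑ q, R q s • V q = modelTuple n (3 + k) l s := by
  let M : Matrix (Fin 3) (Fin 3) ℝ := !![1, 0, 0; 0, x / l, y / l; 0, z / l, w / l]
  have hM : M * Mᵀ = 1 := by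
    have a1 : x / l * (x / l) + y / l * (y / l) = 1 := by field_simp; linarith
    have a2 : z / l * (z / l) + w / l * (w / l) = 1 := by field_simp; linarith
    have a3 : x / l * (z / l) + y / l * (w / l) = 0 := by field_simp; linarith
    have a4 : z / l * (x / l) + w / l * (y / l) = 0 := by linarith
    ext i j
    fin_cases i <;> fin_cases j <;>
      simp [M, Matrix.mul_apply, Fin.sum_univ_three, a1, a2, a3, a4]
  have hM' : Mᵀ * M = 1 := mul_eq_one_comm.1 hM
  have b1 : x / l * x + z / l * z = l := by
    have := congrFun (congrFun hM' 1) 1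
    simp [M, Matrix.mul_apply, Fin.sum_univ_three] at this
    field_simp at this ⊢
    linarith
  have b2 : y / l * y + w / l * w = l := by
    have := congrFun (congrFun hM' 2) 2
    simp [M, Matrix.mul_apply, Fin.sum_univ_three] at this
    field_simp at this ⊢
    linarith
  have b3 : x / l * y + z / l * w = 0 := by
    have := congrFun (congrFun hM' 1) 2
    simp [M, Matrix.mul_apply, Fin.sum_univ_three] at this
    field_simp at this ⊢
    linarith
  have b4 : y / l * x + w / l * z = 0 := by
    rw [← b3]
    ring
  have comb : ∀ s t : ℝ, s • diagBlock n (D2 x + D3 y) + t • diagBlock n (D2 z + D3 w) =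
      diagBlock n (D2 (s * x + t * z) + D3 (s * y + t * w)) := fun s t => by
    rw [← diagBlock_smul, ← diagBlock_smul, ← diagBlock_add]
    congr 1
    ext i j
    fin_cases i <;> fin_cases j <;> simp [D2, D3] <;> ring
  refine ⟨extendOne M, extendOne_mem_orthogonalGroup hM, fun s => ?_⟩
  refine Fin.addCases (fun i => ?_) (fun j => ?_) s
  · rw [sum_extendOne_castAdd, h0, h1, h2]
    fin_cases i
    · simp [M, modelTuple]
    · change (0 : ℝ) • _ + (x / l) • _ + (z / l) • _ = diagBlock n (D2 l)
      rw [zero_smul, zero_add, comb, b1, b3, D3_zero, add_zero]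
    · change (0 : ℝ) • _ + (y / l) • _ + (w / l) • _ = diagBlock n (D3 l)
      rw [zero_smul, zero_add, comb, b2, b4, D2_zero, zero_add]
  · rw [sum_extendOne_natAdd, hV, modelTuple_natAdd]

theorem exists_isSkewSubunit_smul {n m : ℕ} {C : Fin m → Matrix (Fin n) (Fin n) ℝ}
    (hC : ∀ s, (C s)ᵀ = -C s) (hortho : ∀ s t, s ≠ t → frobInner (C s) (C t) = 0) :
    ∃ b : Fin m → Matrix (Fin n) (Fin n) ℝ, IsSkewSubunit b ∧
      ∀ s, C s = √(frobSq (C s)) • b s ∧ (C s ≠ 0 → frobSq (b s) = 1) := by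
  have hne : ∀ {s}, C s ≠ 0 → √(frobSq (C s)) ≠ 0 := fun {s} hs h =>
    hs (frobSq_eq_zero_iff.1 ((Real.sqrt_eq_zero (frobSq_nonneg _)).1 h))
  have hunit : ∀ {s}, C s ≠ 0 → frobSq ((√(frobSq (C s)))⁻¹ • C s) = 1 := fun {s} hs => by
    rw [frobSq_smul, inv_pow, Real.sq_sqrt (frobSq_nonneg _)]
    exact inv_mul_cancel₀ fun h => hs (frobSq_eq_zero_iff.1 h)
  refine ⟨fun s => (√(frobSq (C s)))⁻¹ • C s, ⟨fun s => ?_, fun s t hst => ?_, fun s => ?_⟩,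
    fun s => ⟨?_, hunit⟩⟩
  · rw [Matrix.transpose_smul, hC, smul_neg]
  · rw [frobInner_eq_trace, Matrix.transpose_smul, Matrix.smul_mul, Matrix.mul_smul,
      Matrix.trace_smul, Matrix.trace_smul, ← frobInner_eq_trace, hortho s t hst, smul_zero,
      smul_zero]
  · by_cases hs : C s = 0
    · simp [hs, frobSq_zero]
    · exact (hunit hs).le
  · by_cases hs : C s = 0
    · simp [hs]
    · rw [smul_smul, mul_inv_cancel₀ (hne hs), one_smul]

/-- A pairwise orthogonal tuple of skew-symmetric matrices attaining equality, ordered by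
decreasing norm, is conjugate to a rotation of the model tuple. -/
theorem exists_transform_of_orthogonal {n k : ℕ} (hn : 4 ≤ n)
    {C : Fin (3 + k) → Matrix (Fin n) (Fin n) ℝ} (hC : ∀ s, (C s)ᵀ = -C s)
    (hortho : ∀ s t, s ≠ t → frobInner (C s) (C t) = 0)
    (hanti : Antitone fun s => frobSq (C s))
    (heq : ∑ r, ∑ s, frobSq (matComm (C r) (C s)) = (2 / 3) * (∑ r, frobSq (C r)) ^ 2) :
    ∃ P ∈ Matrix.orthogonalGroup (Fin n) ℝ, ∃ R ∈ Matrix.orthogonalGroup (Fin (3 + k)) ℝ,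
      ∃ l : ℝ, 0 ≤ l ∧ ∀ s, ∑ q, R q s • (Pᵀ * C q * P) = modelTuple n (3 + k) l s := by
  obtain ⟨b, hb, hCb⟩ := exists_isSkewSubunit_smul hC hortho
  have hcomm : ∀ r s, frobSq (matComm (C r) (C s)) =
      frobSq (C r) * frobSq (C s) * frobSq (matComm (b r) (b s)) := fun r s => by
    conv_lhs => rw [(hCb r).1, (hCb s).1, matComm_smul_smul, frobSq_smul, mul_pow,
      Real.sq_sqrt (frobSq_nonneg _), Real.sq_sqrt (frobSq_nonneg _)]
  simp only [hcomm] at heq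
  obtain ⟨x1, x2, hx, ha⟩ := eq_of_weighted_sum_eq (fun s => frobSq_nonneg (C s)) hanti
    (fun r s => (frobSq_matComm_le (hb.skew r) (hb.skew s) (hb.le_one r)).trans (hb.le_one s))
    (fun r => by rw [matComm_self, frobSq_zero]) (fun r s => frobSq_matComm_comm (b r) (b s))
    (fun r J => (Finset.sum_le_sum fun s _ => by linarith [hb.le_one s]).trans
      (hb.sum_frobSq_matComm_le r J)) heq
  simp only [frobSq_eq_zero_iff] at hx
  by_cases h0 : C (Fin.castAdd k 0) = 0
  · have hz : ∀ s, C s = 0 := fun s => by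
      refine frobSq_eq_zero_iff.1 (le_antisymm ?_ (frobSq_nonneg _))
      rw [← frobSq_eq_zero_iff] at h0
      exact (hanti (Nat.zero_le _ : Fin.castAdd k 0 ≤ s)).trans h0.le
    refine ⟨1, one_mem _, 1, one_mem _, 0, le_rfl, fun s => ?_⟩
    simp [hz, modelTuple, D1_zero, D2_zero, D3_zero, diagBlock_zero]
  · set x0 := frobSq (C (Fin.castAdd k 0)) with hx0
    have hx0ne : x0 ≠ 0 := fun h => h0 (frobSq_eq_zero_iff.1 h)
    have hx0pos : 0 < x0 := lt_of_le_of_ne (frobSq_nonneg _) hx0ne.symm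
    obtain ⟨a1, a2⟩ := ha hx0ne
    have hA1 := (hCb (Fin.castAdd k 0)).2 h0
    have hne1 : C (Fin.castAdd k 1) ≠ 0 := fun h => hx0ne (by rw [← x1, h, frobSq_zero])
    have hbC : ∀ s, frobSq (matComm (b (Fin.castAdd k 0)) (b s)) = 1 →
        frobSq (matComm (b (Fin.castAdd k 0)) (C s)) = frobSq (C s) := fun s hs => by
      conv_lhs => rw [(hCb s).1, ← one_smul ℝ (b (Fin.castAdd k 0)), matComm_smul_smul, one_mul,
        frobSq_smul, hs, mul_one, Real.sq_sqrt (frobSq_nonneg _)]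
    obtain ⟨P, hP, hPA, hPB⟩ := exists_conj_eq_diagBlock hn (hb.skew (Fin.castAdd k 0)) hA1
      (hC (Fin.castAdd k 1)) hne1 (hbC _ a1)
    obtain ⟨x, y, e1⟩ := hPB _ (hC _) (hbC _ a1)
    obtain ⟨z, w, e2⟩ := hPB _ (hC _) (hbC _ a2)
    have e0 : Pᵀ * C (Fin.castAdd k 0) * P = diagBlock n (D1 (√x0 * (1 / 2))) := by
      rw [(hCb (Fin.castAdd k 0)).1, Matrix.mul_smul, Matrix.smul_mul, hPA, ← diagBlock_smul,
        ← D1_mul]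
    have hin : ∀ {s t X Y}, Pᵀ * C s * P = diagBlock n X → Pᵀ * C t * P = diagBlock n Y →
        frobInner (C s) (C t) = frobInner X Y := fun {s t X Y} hX hY => by
      rw [← frobInner_conj hP, hX, hY, frobInner_diagBlock hn]
    have hsq : (√x0 * (1 / 2)) ^ 2 = x0 / 4 := by
      rw [mul_pow, Real.sq_sqrt hx0pos.le]
      ring
    have i1 := hin e1 e1
    have i2 := hin e2 e2
    have i3 := hin e1 e2
    rw [frobInner_self, x1, frobInner_D2_add_D3] at i1
    rw [frobInner_self, x2, frobInner_D2_add_D3] at i2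
    rw [hortho _ _ (fun h => by simp [Fin.ext_iff] at h), frobInner_D2_add_D3] at i3
    obtain ⟨R, hR, hRV⟩ := exists_rotation_modelTuple
      (V := fun q => Pᵀ * C q * P) (mul_pos (Real.sqrt_pos.2 hx0pos) one_half_pos).ne'
      (by rw [hsq]; linarith) (by rw [hsq]; linarith) (by linarith) e0 e1 e2
      (fun j => by simp [hx j])
    exact ⟨P, hP, R, hR, √x0 * (1 / 2), by positivity, hRV⟩

/-- Equality characterization in the commutator inequality for skew-symmetric
`n × n` matrices, `n ≥ 4`. -/
theorem ddvv_skew_equality (n m : ℕ) (hn : 4 ≤ n) (hm : 3 ≤ m)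
    (B : Fin m → Matrix (Fin n) (Fin n) ℝ)
    (hskew : ∀ r, (B r)ᵀ = -B r) :
    (∑ r, ∑ s, frobSq (matComm (B r) (B s)) = (2 / 3) * (∑ r, frobSq (B r)) ^ 2) ↔
      ∃ P ∈ Matrix.orthogonalGroup (Fin n) ℝ, ∃ R ∈ Matrix.orthogonalGroup (Fin m) ℝ,
        ∃ l : ℝ, 0 ≤ l ∧
          (fun s : Fin m => ∑ r, R r s • (Pᵀ * B r * P)) =
            fun s : Fin m =>
              if (s : ℕ) = 0 then diagBlock n (D1 l)
              else if (s : ℕ) = 1 then diagBlock n (D2 l)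
              else if (s : ℕ) = 2 then diagBlock n (D3 l)
              else 0 := by
  change _ ↔ ∃ P ∈ Matrix.orthogonalGroup (Fin n) ℝ, ∃ R ∈ Matrix.orthogonalGroup (Fin m) ℝ,
    ∃ l : ℝ, 0 ≤ l ∧ (fun s : Fin m => ∑ r, R r s • (Pᵀ * B r * P)) = modelTuple n m l
  constructor
  · intro heq
    obtain ⟨k, rfl⟩ := Nat.exists_eq_add_of_le hm
    obtain ⟨R₁, hR₁, hortho, hanti⟩ := exists_rotation_orthogonal B
    obtain ⟨P, hP, R₂, hR₂, l, hl, h⟩ := exists_transform_of_orthogonal hn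
      (C := fun s => ∑ r, R₁ r s • B r)
      (fun s => by simp only [Matrix.transpose_sum, Matrix.transpose_smul, hskew, smul_neg,
        Finset.sum_neg_distrib])
      hortho hanti (by rw [sum_frobSq_matComm_rotate hR₁, sum_frobSq_rotate hR₁, heq])
    exact ⟨P, hP, R₁ * R₂, mul_mem hR₁ hR₂, l, hl,
      funext fun s => (sum_mul_smul_conj R₁ R₂ P B s).trans (h s)⟩
  · rintro ⟨P, hP, R, hR, l, -, h⟩
    exact (equality_iff_of_transform hP hR B fun s => (congrFun h s).symm).1
      (modelTuple_equality hn hm l)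
end

section
/- (Böttcher–Wenzel inequality) For any two real n×n matrices X and Y, the squared Frobenius norm of their commutator satisfies ‖[X,Y]‖² ≤ 2·‖X‖²·‖Y‖². -/
open Matrix BigOperators

theorem frobSq_eq_trace {n : ℕ} (A : Matrix (Fin n) (Fin n) ℝ) :
    frobSq A = trace (Aᵀ * A) := by
  simp only [frobSq, trace, diag_apply, mul_apply, transpose_apply, sq]
  exact Finset.sum_comm

theorem frobSq_transpose {n : ℕ} (A : Matrix (Fin n) (Fin n) ℝ) : frobSq Aᵀ = frobSq A :=
  Finset.sum_comm

/-- Cauchy–Schwarz for the Frobenius inner product. -/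
theorem sq_trace_transpose_mul_le {n : ℕ} (A B : Matrix (Fin n) (Fin n) ℝ) :
    trace (Aᵀ * B) ^ 2 ≤ frobSq A * frobSq B := by
  have h := Finset.sum_mul_sq_le_sq_mul_sq (Finset.univ : Finset (Fin n × Fin n))
    (fun p => A p.1 p.2) (fun p => B p.1 p.2)
  simp only [Fintype.sum_prod_type] at h
  have e : trace (Aᵀ * B) = ∑ i, ∑ j, A i j * B i j := by
    simp only [trace, diag_apply, mul_apply, transpose_apply]
    exact Finset.sum_comm
  rw [e]
  exact h

/-- A skew-symmetric matrix has operator norm at most its Frobenius norm over `√2`. -/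
theorem two_mul_dotProduct_mulVec_le {n : ℕ} {A : Matrix (Fin n) (Fin n) ℝ} (hA : Aᵀ = -A)
    (v : Fin n → ℝ) :
    2 * ((A *ᵥ v) ⬝ᵥ (A *ᵥ v)) ≤ frobSq A * (v ⬝ᵥ v) := by
  have hskew : ∀ i j, A i j = -A j i := fun i j => by
    simpa using congrFun (congrFun hA j) i
  set w := A *ᵥ v with hw
  set c := v ⬝ᵥ v with hc
  set q := w ⬝ᵥ w with hq
  rcases eq_or_ne c 0 with h0 | h0
  · have hv : v = 0 := dotProduct_self_eq_zero.1 h0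
    have hq0 : q = 0 := by rw [hq, hw, hv]; simp
    rw [hq0, h0]; simp
  have hcpos : 0 < c := lt_of_le_of_ne
    (Finset.sum_nonneg fun i _ => mul_self_nonneg (v i)) (Ne.symm h0)
  have h1 : ∑ i, ∑ j, A i j * (w i * v j) = q := by
    simp only [hq, hw, dotProduct, mulVec, Finset.mul_sum]
    refine Finset.sum_congr rfl fun i _ => Finset.sum_congr rfl fun j _ => by ring
  have h2 : ∑ i, ∑ j, A i j * (v i * w j) = -q := by
    rw [Finset.sum_comm, ← h1, ← Finset.sum_neg_distrib]
    refine Finset.sum_congr rfl fun i _ => ?_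
    rw [← Finset.sum_neg_distrib]
    refine Finset.sum_congr rfl fun j _ => ?_
    rw [hskew j i]; ring
  have h3 : w ⬝ᵥ v = 0 := by
    have e1 : ∑ i, ∑ j, A i j * (v i * v j) = w ⬝ᵥ v := by
      simp only [hw, dotProduct, mulVec, Finset.sum_mul]
      refine Finset.sum_congr rfl fun i _ => Finset.sum_congr rfl fun j _ => by ring
    have e2 : ∑ i, ∑ j, A i j * (v i * v j) = -(w ⬝ᵥ v) := by
      rw [Finset.sum_comm, ← e1, ← Finset.sum_neg_distrib]
      refine Finset.sum_congr rfl fun i _ => ?_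
      rw [← Finset.sum_neg_distrib]
      refine Finset.sum_congr rfl fun j _ => ?_
      rw [hskew j i]; ring
    linarith
  have h4 : ∑ i, ∑ j, (w i * w i) * (v j * v j) = q * c := by
    simp only [hq, hc, dotProduct, Finset.sum_mul_sum]
  have h5 : ∑ i, ∑ j, (v i * v i) * (w j * w j) = c * q := by
    simp only [hq, hc, dotProduct, Finset.sum_mul_sum]
  have h6 : ∑ i, ∑ j, (w i * v i) * (w j * v j) = 0 := by
    rw [← Finset.sum_mul_sum]
    change (w ⬝ᵥ v) * (w ⬝ᵥ v) = 0
    rw [h3, zero_mul]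
  have key : 0 ≤ ∑ i, ∑ j, (c * A i j - (w i * v j - v i * w j)) ^ 2 :=
    Finset.sum_nonneg fun _ _ => Finset.sum_nonneg fun _ _ => sq_nonneg _
  have expand : ∑ i, ∑ j, (c * A i j - (w i * v j - v i * w j)) ^ 2 =
      c ^ 2 * frobSq A - 2 * c * (∑ i, ∑ j, A i j * (w i * v j))
        + 2 * c * (∑ i, ∑ j, A i j * (v i * w j))
        + ∑ i, ∑ j, (w i * w i) * (v j * v j) + ∑ i, ∑ j, (v i * v i) * (w j * w j)
        - 2 * ∑ i, ∑ j, (w i * v i) * (w j * v j) := by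
    simp only [frobSq, Finset.mul_sum, ← Finset.sum_add_distrib, ← Finset.sum_sub_distrib]
    refine Finset.sum_congr rfl fun i _ => Finset.sum_congr rfl fun j _ => by ring
  rw [expand, h1, h2, h4, h5, h6] at key
  have : 0 ≤ c * (frobSq A * c - 2 * q) := by linarith
  linarith [nonneg_of_mul_nonneg_right this hcpos]

theorem two_mul_frobSq_mul_le {n : ℕ} {A : Matrix (Fin n) (Fin n) ℝ} (hA : Aᵀ = -A)
    (Y : Matrix (Fin n) (Fin n) ℝ) :
    2 * frobSq (A * Y) ≤ frobSq A * frobSq Y := by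
  have e : ∀ Z : Matrix (Fin n) (Fin n) ℝ, frobSq Z = ∑ j, Z.col j ⬝ᵥ Z.col j := fun Z => by
    rw [← frobSq_transpose]
    simp only [frobSq, dotProduct, transpose_apply, col_apply, sq]
  rw [e (A * Y), e Y, Finset.mul_sum, Finset.mul_sum]
  exact Finset.sum_le_sum fun j _ => two_mul_dotProduct_mulVec_le hA (Y.col j)

/-- A form of Popoviciu's inequality for the variance of a finite distribution of mass `2 * N`. -/
theorem two_mul_sum_mul_sq_le {n : ℕ} (p l : Fin n → ℝ) (hp : ∀ i, 0 ≤ p i) {N : ℝ} (hN : 0 < N)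
    (hsum : ∑ i, p i = 2 * N) :
    2 * ∑ i, p i * l i ^ 2 - (∑ i, p i * l i) ^ 2 / N ≤ 2 * (∑ i, l i ^ 2) * N := by
  have hne : Nonempty (Fin n) := by
    by_contra h
    rw [not_nonempty_iff] at h
    simp at hsum
    exact hN.ne' hsum
  obtain ⟨a, ha⟩ := Finite.exists_max l
  obtain ⟨b, hb⟩ := Finite.exists_min l
  set μ := ∑ i, p i * l i with hμ
  have h1 : 0 ≤ ∑ i, p i * ((l a - l i) * (l i - l b)) :=
    Finset.sum_nonneg fun i _ => mul_nonneg (hp i)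
      (mul_nonneg (sub_nonneg.2 (ha i)) (sub_nonneg.2 (hb i)))
  have h2 : ∑ i, p i * ((l a - l i) * (l i - l b)) =
      (l a + l b) * μ - l a * l b * (2 * N) - ∑ i, p i * l i ^ 2 := by
    rw [← hsum, hμ]
    simp only [Finset.mul_sum, ← Finset.sum_sub_distrib]
    refine Finset.sum_congr rfl fun i _ => by ring
  have h3 : (l a - l b) ^ 2 ≤ 2 * ∑ i, l i ^ 2 := by
    rcases eq_or_ne a b with h | h
    · rw [h, sub_self]
      have : 0 ≤ ∑ i, l i ^ 2 := Finset.sum_nonneg fun _ _ => sq_nonneg _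
      simpa using this
    · have : ∑ i ∈ {a, b}, l i ^ 2 ≤ ∑ i, l i ^ 2 :=
        Finset.sum_le_sum_of_subset_of_nonneg (Finset.subset_univ _) fun _ _ _ => sq_nonneg _
      rw [Finset.sum_pair h] at this
      nlinarith [sq_nonneg (l a + l b)]
  have h4 : 2 * (l a + l b) * μ - μ ^ 2 / N ≤ N * (l a + l b) ^ 2 := by
    have : 0 ≤ (μ - N * (l a + l b)) ^ 2 / N := by positivity
    have e : (μ - N * (l a + l b)) ^ 2 / N =
        μ ^ 2 / N - 2 * (l a + l b) * μ + N * (l a + l b) ^ 2 := by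
      field_simp
      ring
    linarith
  have h5 := mul_le_mul_of_nonneg_right h3 hN.le
  linarith

theorem two_mul_trace_mul_sq_le {n : ℕ} {S R : Matrix (Fin n) (Fin n) ℝ} (hS : S.IsHermitian)
    (hR : R.PosSemidef) {N : ℝ} (hN : 0 < N) (htr : trace R = 2 * N) :
    2 * trace (R * (S * S)) - trace (R * S) ^ 2 / N ≤ 2 * trace (S * S) * N := by
  set U : Matrix (Fin n) (Fin n) ℝ := hS.eigenvectorUnitary.1
  set l := hS.eigenvalues
  have hUU : star U * U = 1 := Unitary.coe_star_mul_self hS.eigenvectorUnitary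
  have hUU' : U * star U = 1 := Unitary.coe_mul_star_self hS.eigenvectorUnitary
  have hspec : S = U * diagonal l * star U := by
    have := hS.spectral_theorem
    rw [Unitary.conjStarAlgAut_apply] at this
    exact this
  have hSS : S * S = U * diagonal (fun i => l i ^ 2) * star U := by
    have e : diagonal (fun i => l i ^ 2) = diagonal l * diagonal l := by
      rw [diagonal_mul_diagonal]; simp only [sq]
    rw [e]
    conv_lhs => rw [hspec]
    calc U * diagonal l * star U * (U * diagonal l * star U)
        = U * diagonal l * (star U * U) * diagonal l * star U := by simp only [Matrix.mul_assoc]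
      _ = _ := by rw [hUU]; simp only [Matrix.mul_assoc, Matrix.one_mul]
  set Q := star U * R * U with hQ
  have hQpos : Q.PosSemidef := hR.conjTranspose_mul_mul_same U
  have hconj : ∀ d : Fin n → ℝ, trace (R * (U * diagonal d * star U)) = ∑ i, Q i i * d i := by
    intro d
    have : trace (R * (U * diagonal d * star U)) = trace (Q * diagonal d) := by
      rw [← Matrix.mul_assoc, trace_mul_comm, hQ]
      simp only [Matrix.mul_assoc]
    rw [this]
    simp only [trace, diag_apply, mul_diagonal]
  have hQtr : ∑ i, Q i i = 2 * N := by
    rw [← htr]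
    change trace Q = _
    rw [hQ, trace_mul_comm, ← Matrix.mul_assoc, hUU', Matrix.one_mul]
  have hStr : trace (S * S) = ∑ i, l i ^ 2 := by
    rw [hSS, trace_mul_comm, ← Matrix.mul_assoc, hUU, Matrix.one_mul, trace_diagonal]
  have hRS : trace (R * S) = ∑ i, Q i i * l i := by
    rw [← hconj, ← hspec]
  rw [hStr, hRS, hSS, hconj]
  exact two_mul_sum_mul_sq_le _ _ (fun i => hQpos.diag_nonneg) hN hQtr

theorem frobSq_matComm_add_frobSq {n : ℕ} (X Y : Matrix (Fin n) (Fin n) ℝ) :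
    frobSq (matComm X Y) + frobSq (Xᵀ * Y + Y * Xᵀ) =
      trace ((Y * Yᵀ + Yᵀ * Y) * (Xᵀ * X + X * Xᵀ)) := by
  simp only [frobSq_eq_trace, matComm, transpose_sub, transpose_add, transpose_mul,
    transpose_transpose, Matrix.mul_add, Matrix.add_mul, Matrix.mul_sub, Matrix.sub_mul,
    trace_add, trace_sub, Matrix.mul_assoc]
  have cyc : ∀ A B C D : Matrix (Fin n) (Fin n) ℝ,
      trace (A * (B * (C * D))) = trace (B * (C * (D * A))) := fun A B C D => by
    rw [trace_mul_comm]; simp only [Matrix.mul_assoc]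
  rw [cyc X Yᵀ Xᵀ Y, cyc X Yᵀ Y Xᵀ, cyc Xᵀ Yᵀ X Y, cyc Xᵀ Yᵀ Y X, cyc Y Yᵀ Xᵀ X, cyc Y Yᵀ X Xᵀ]
  ring

/-- The Böttcher–Wenzel inequality. -/
theorem boettcher_wenzel (n : ℕ) (X Y : Matrix (Fin n) (Fin n) ℝ) :
    frobSq (matComm X Y) ≤ 2 * frobSq X * frobSq Y := by
  rcases (frobSq_nonneg Y).eq_or_lt with hY | hN
  · have h0 : Y = 0 := by
      rw [frobSq_eq_trace] at hY
      have := (trace_conjTranspose_mul_self_eq_zero_iff (A := Y)).1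
      rw [conjTranspose_eq_transpose_of_trivial] at this
      exact this hY.symm
    simp [h0, matComm, frobSq]
  set N := frobSq Y with hNdef
  set R := Y * Yᵀ + Yᵀ * Y with hR
  have hRpos : R.PosSemidef := by
    have h1 := posSemidef_self_mul_conjTranspose Y
    have h2 := posSemidef_conjTranspose_mul_self Y
    rw [conjTranspose_eq_transpose_of_trivial] at h1 h2
    exact h1.add h2
  have hRtr : trace R = 2 * N := by
    rw [hR, trace_add, trace_mul_comm, ← frobSq_eq_trace, two_mul]
  set S := (2⁻¹ : ℝ) • (X + Xᵀ) with hSdef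
  set A := (2⁻¹ : ℝ) • (X - Xᵀ) with hAdef
  have hSt : Sᵀ = S := by
    rw [hSdef, transpose_smul, transpose_add, transpose_transpose, add_comm]
  have hAt : Aᵀ = -A := by
    rw [hAdef, transpose_smul, transpose_sub, transpose_transpose, ← smul_neg, neg_sub]
  have hX : X = S + A := by
    rw [hSdef, hAdef, ← smul_add]
    ext i j; simp; ring
  have hXt : Xᵀ = S - A := by rw [hX, transpose_add, hSt, hAt, sub_eq_add_neg]
  have hsum : Xᵀ * X + X * Xᵀ = (2 : ℝ) • (S * S) + (2 : ℝ) • (Aᵀ * A) := by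
    rw [hXt, hX, hAt, two_smul, two_smul]
    noncomm_ring
  have hXnorm : frobSq X = trace (S * S) + frobSq A := by
    have h := congrArg trace hsum
    rw [trace_add, trace_mul_comm X, ← frobSq_eq_trace, trace_add, trace_smul, trace_smul,
      ← frobSq_eq_trace, smul_eq_mul, smul_eq_mul] at h
    linarith
  have hSherm : S.IsHermitian := by
    rw [IsHermitian, conjTranspose_eq_transpose_of_trivial, hSt]
  have hskew : trace (R * (Aᵀ * A)) ≤ frobSq A * N := by
    have h1 := two_mul_frobSq_mul_le hAt Y
    have h2 := two_mul_frobSq_mul_le hAt Yᵀ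
    have e : trace (R * (Aᵀ * A)) = frobSq (A * Y) + frobSq (A * Yᵀ) := by
      rw [frobSq_eq_trace, frobSq_eq_trace, hR, Matrix.add_mul, trace_add, transpose_mul,
        transpose_mul, transpose_transpose, Matrix.mul_assoc Y, trace_mul_comm Y,
        Matrix.mul_assoc Yᵀ Y, trace_mul_comm Yᵀ]
      simp only [Matrix.mul_assoc]
    rw [frobSq_transpose] at h2
    linarith
  have hRA : trace (R * A) = 0 := by
    have hRt : Rᵀ = R := by
      rw [hR, transpose_add, transpose_mul, transpose_mul, transpose_transpose]
    have h : trace (R * A) = -trace (R * A) := by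
      conv_lhs => rw [← trace_transpose, transpose_mul, hAt, hRt, Matrix.neg_mul, trace_neg,
        trace_mul_comm]
    linarith
  have hcs : trace (R * S) ^ 2 / N ≤ frobSq (Xᵀ * Y + Y * Xᵀ) := by
    have h := sq_trace_transpose_mul_le Y (Xᵀ * Y + Y * Xᵀ)
    have e : trace (Yᵀ * (Xᵀ * Y + Y * Xᵀ)) = trace (R * S) := by
      have : trace (R * Xᵀ) = trace (R * S) := by
        rw [hXt, Matrix.mul_sub, trace_sub, hRA, sub_zero]
      rw [← this, hR, Matrix.mul_add, Matrix.add_mul, trace_add, trace_add,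
        Matrix.mul_assoc Y, trace_mul_comm Y]
      simp only [Matrix.mul_assoc]
    rw [e] at h
    rw [div_le_iff₀ hN]
    linarith
  have hmain := frobSq_matComm_add_frobSq X Y
  rw [← hR, hsum, Matrix.mul_add, trace_add, Matrix.mul_smul R _ (S * S),
    Matrix.mul_smul R _ (Aᵀ * A), trace_smul, trace_smul, smul_eq_mul, smul_eq_mul] at hmain
  have hsymm := two_mul_trace_mul_sq_le hSherm hRpos hN hRtr
  rw [hXnorm]
  linarith
end
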